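/- Under assumptions (A1)-(A3), there exist constants δ, c > 0 such that E(sup_{t∈[k,k+1]} exp(δ‖X_t^ξ‖_∞²)) ≤ exp(c(1+‖ξ‖_∞²)) for every integer k ≥ 0 and every ξ ∈ 𝒞. -/

import Mathlib

open MeasureTheory ProbabilityTheory Filter Set
open scoped RealInnerProductSpace ENNReal NNReal Topology

noncomputable section

/-- Euclidean state space `ℝ^d`. -/
abbrev EucSp (d : ℕ) := EuclideanSpace ℝ (Fin d)

/-- The path (segment) space `𝒞 = C([-r₀,0];ℝ^d)` with the uniform norm. -/
abbrev Seg (d : ℕ) (r₀ : ℝ) := C(Set.Icc (-r₀) (0:ℝ), EucSp d)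

instance (d : ℕ) (r₀ : ℝ) : MeasurableSpace (Seg d r₀) := borel _
instance (d : ℕ) (r₀ : ℝ) : BorelSpace (Seg d r₀) := ⟨rfl⟩

/-- Evaluation of a segment at time `0`. -/
def ev0 {d : ℕ} {r₀ : ℝ} (h : 0 < r₀) (ξ : Seg d r₀) : EucSp d :=
  ξ ⟨0, ⟨neg_nonpos.mpr h.le, le_rfl⟩⟩

/-- The setting of the path-dependent SDE `dX(t) = b(X_t)dt + σ(X_t)dW(t)` under
assumptions (A1) (continuity), (A2) (dissipativity) and (A3) (invertibility).
`Y ξ` is the real-time solution path started from the initial segment `ξ`, `X ξ t` is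
the associated segment (window) process, adapted to the filtration `ℱ`.  The SDE itself
is encoded through the Stroock–Varadhan martingale-problem formulation (`hSDE₁`,
`hSDE₂`), which characterizes (weak) solutions driven by a `d`-dimensional Brownian
motion, and `hMarkov` is the Markov (Chapman–Kolmogorov) property of the segment
process. -/
structure PathSDE (d : ℕ) (r₀ : ℝ) (Ω : Type) [mΩ : MeasurableSpace Ω]
    (P : Measure Ω) where
  hr₀ : 0 < r₀
  hP : IsProbabilityMeasure P
  b : Seg d r₀ → EucSp d
  σ : Seg d r₀ → (EucSp d →L[ℝ] EucSp d)
  ℱ : Filtration ℝ mΩ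
  Y : Seg d r₀ → Ω → ℝ → EucSp d
  X : Seg d r₀ → ℝ → Ω → Seg d r₀
  hYcont : ∀ ξ ω, Continuous (Y ξ ω)
  hY0 : ∀ (ξ : Seg d r₀) (ω : Ω) (θ : Set.Icc (-r₀) (0:ℝ)), Y ξ ω θ.1 = ξ θ
  hX : ∀ (ξ : Seg d r₀), ∀ t ≥ (0:ℝ), ∀ (ω : Ω) (θ : Set.Icc (-r₀) (0:ℝ)),
    X ξ t ω θ = Y ξ ω (t + θ.1)
  hXadapted : ∀ (ξ : Seg d r₀), ∀ t ≥ (0:ℝ),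
    @MeasureTheory.StronglyMeasurable Ω (Seg d r₀) _ (ℱ t) (X ξ t)
  -- (A1) continuity assumptions
  hA1σ : ∃ L : ℝ≥0, LipschitzWith L σ
  hA1bcont : Continuous b
  hA1bbdd : ∀ R : ℝ, ∃ C : ℝ, ∀ ξ : Seg d r₀, ‖ξ‖ ≤ R → ‖b ξ‖ ≤ C
  -- (A2) dissipativity
  hA2 : ∃ l₁ l₂ : ℝ, 0 < l₁ ∧ 0 < l₂ ∧ l₂ * Real.exp (l₁ * r₀) < l₁ ∧
    ∀ ξ η : Seg d r₀,
      2 * ⟪ev0 hr₀ ξ - ev0 hr₀ η, b ξ - b η⟫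
        ≤ -l₁ * ‖ev0 hr₀ ξ - ev0 hr₀ η‖ ^ 2 + l₂ * ‖ξ - η‖ ^ 2
  -- (A3) invertibility and boundedness of σ
  σinv : Seg d r₀ → (EucSp d →L[ℝ] EucSp d)
  hσinv : ∀ ξ, (σ ξ).comp (σinv ξ) = ContinuousLinearMap.id ℝ (EucSp d) ∧
      (σinv ξ).comp (σ ξ) = ContinuousLinearMap.id ℝ (EucSp d)
  hA3 : ∃ C : ℝ, ∀ ξ, ‖σ ξ‖ + ‖σinv ξ‖ ≤ C
  -- martingale problem formulation of the SDE (weak solution)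
  hSDE₁ : ∀ (ξ : Seg d r₀) (u : EucSp d),
    Martingale (fun t ω =>
      ⟪u, Y ξ ω (max t 0)⟫ - ⟪u, ev0 hr₀ ξ⟫
        - ∫ s in (0:ℝ)..(max t 0), ⟪u, b (X ξ s ω)⟫) ℱ P
  hSDE₂ : ∀ (ξ : Seg d r₀) (u v : EucSp d),
    Martingale (fun t ω =>
      (⟪u, Y ξ ω (max t 0)⟫ - ⟪u, ev0 hr₀ ξ⟫
        - ∫ s in (0:ℝ)..(max t 0), ⟪u, b (X ξ s ω)⟫) *
      (⟪v, Y ξ ω (max t 0)⟫ - ⟪v, ev0 hr₀ ξ⟫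
        - ∫ s in (0:ℝ)..(max t 0), ⟪v, b (X ξ s ω)⟫)
      - ∫ s in (0:ℝ)..(max t 0),
          ⟪(ContinuousLinearMap.adjoint (σ (X ξ s ω))) u,
            (ContinuousLinearMap.adjoint (σ (X ξ s ω))) v⟫) ℱ P
  -- Markov property (Chapman–Kolmogorov) of the segment process
  hMarkov : ∀ (f : Seg d r₀ → ℝ), Measurable f → (∃ C, ∀ ζ, |f ζ| ≤ C) →
    ∀ s ≥ (0:ℝ), ∀ t ≥ (0:ℝ), ∀ ξ,
      (∫ ω, f (X ξ (s + t) ω) ∂P) = ∫ ω, ∫ ω', f (X (X ξ s ω) t ω') ∂P ∂P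

variable {d : ℕ} {r₀ : ℝ} {Ω : Type} [mΩ : MeasurableSpace Ω] {P : Measure Ω}

/-- The Markov semigroup `P_t f(ξ) = E f(X_t^ξ)`. -/
def PathSDE.Pt (S : PathSDE d r₀ Ω P) (t : ℝ) (f : Seg d r₀ → ℝ) (ξ : Seg d r₀) : ℝ :=
  ∫ ω, f (S.X ξ t ω) ∂P

/-- `μ` is an invariant probability measure of the semigroup `P_t`. -/
def PathSDE.Invariant (S : PathSDE d r₀ Ω P) (μ : Measure (Seg d r₀)) : Prop :=
  IsProbabilityMeasure μ ∧
  ∀ (f : Seg d r₀ → ℝ), Measurable f → (∃ C, ∀ ζ, |f ζ| ≤ C) →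
    ∀ t ≥ (0:ℝ), ∫ ξ, S.Pt t f ξ ∂μ = ∫ ξ, f ξ ∂μ

/-- The quasi-metric `ρ_{p,γ}(ξ,η) = (1 ∧ ‖ξ-η‖_∞^γ) √(1+‖ξ‖_∞^p+‖η‖_∞^p)`. -/
def qdist (p γ : ℝ) (ξ η : Seg d r₀) : ℝ :=
  min 1 (‖ξ - η‖ ^ γ) * Real.sqrt (1 + ‖ξ‖ ^ p + ‖η‖ ^ p)

/-- The norm `‖f‖_{p,γ}` on the class `C_{p,γ}(𝒞)` (with the convention `x/0 = 0`,
so that the diagonal does not contribute to the second supremum). -/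
def pgNorm (p γ : ℝ) (f : Seg d r₀ → ℝ) : ℝ :=
  (⨆ ξ : Seg d r₀, |f ξ| / (1 + ‖ξ‖ ^ (p / 2))) +
  ⨆ q : Seg d r₀ × Seg d r₀, |f q.1 - f q.2| / qdist p γ q.1 q.2

/-- Membership in the class `C_{p,γ}(𝒞)`: continuity together with finiteness of the
two suprema defining `‖f‖_{p,γ}`. -/
def MemCpg (p γ : ℝ) (f : Seg d r₀ → ℝ) : Prop :=
  Continuous f ∧
  BddAbove (Set.range fun ξ : Seg d r₀ => |f ξ| / (1 + ‖ξ‖ ^ (p / 2))) ∧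
  BddAbove (Set.range fun q : Seg d r₀ × Seg d r₀ => |f q.1 - f q.2| / qdist p γ q.1 q.2)

/-- The additive functional `A_t^f(ξ) = (1/t)∫₀^t f(X_s^ξ) ds`. -/
def timeAvg (S : PathSDE d r₀ Ω P) (f : Seg d r₀ → ℝ) (ξ : Seg d r₀) (t : ℝ) (ω : Ω) : ℝ :=
  (∫ s in (0:ℝ)..t, f (S.X ξ s ω)) / t

/-- `π` is a coupling of `μ` and `ν`. -/
def IsCoupling (μ ν : Measure (Seg d r₀)) (π : Measure (Seg d r₀ × Seg d r₀)) : Prop :=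
  π.map Prod.fst = μ ∧ π.map Prod.snd = ν

/-- Membership in `𝒫_{p,γ}(𝒞)`: probability measures with `(μ×μ)(ρ_{p,γ}) < ∞`. -/
def MemPpg (p γ : ℝ) (μ : Measure (Seg d r₀)) : Prop :=
  IsProbabilityMeasure μ ∧
    Integrable (fun q : Seg d r₀ × Seg d r₀ => qdist p γ q.1 q.2) (μ.prod μ)

/-- The Wasserstein "distance" `W_{p,γ}` associated with the quasi-metric `ρ_{p,γ}`. -/
def Wpg (p γ : ℝ) (μ ν : Measure (Seg d r₀)) : ℝ :=
  sInf {r : ℝ | ∃ π : Measure (Seg d r₀ × Seg d r₀),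
    IsCoupling μ ν π ∧ r = ∫ q, qdist p γ q.1 q.2 ∂π}

/-- `μ P_t`: the law of the segment `X_t` when `X_0` is distributed as `μ`. -/
def PathSDE.lawAt (S : PathSDE d r₀ Ω P) (μ : Measure (Seg d r₀)) (t : ℝ) :
    Measure (Seg d r₀) :=
  μ.bind fun ξ => P.map (S.X ξ t)

/-- The corrector `R_f(ξ) = ∫₀^∞ {P_t f(ξ) − μ∞(f)} dt`. -/
def Rcorr (S : PathSDE d r₀ Ω P) (μinf : Measure (Seg d r₀)) (f : Seg d r₀ → ℝ)
    (ξ : Seg d r₀) : ℝ :=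
  ∫ t in Set.Ioi (0:ℝ), (S.Pt t f ξ - ∫ η, f η ∂μinf)

/-- `φ_f(ξ) = E|∫₀¹ f(X_r^ξ)dr + R_f(X_1^ξ) − R_f(ξ)|²`. -/
def phiF (S : PathSDE d r₀ Ω P) (μinf : Measure (Seg d r₀)) (f : Seg d r₀ → ℝ)
    (ξ : Seg d r₀) : ℝ :=
  ∫ ω, ((∫ r in (0:ℝ)..1, f (S.X ξ r ω))
      + Rcorr S μinf f (S.X ξ 1 ω) - Rcorr S μinf f ξ) ^ 2 ∂P

/-- `D_f = √(μ∞(φ_f))`. -/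
def DF (S : PathSDE d r₀ Ω P) (μinf : Measure (Seg d r₀)) (f : Seg d r₀ → ℝ) : ℝ :=
  Real.sqrt (∫ ξ, phiF S μinf f ξ ∂μinf)

/-- `Φ_D`: distribution function of the centered normal law with variance `D`
(`Φ_0 = 1_{[0,∞)}`). -/
def PhiD (D : ℝ) (z : ℝ) : ℝ :=
  if D = 0 then (if 0 ≤ z then 1 else 0)
  else (gaussianReal 0 D.toNNReal (Set.Iic z)).toReal

/-- `R̂_f(ξ) = Σ_{k=0}^∞ P_k f(ξ)` (discrete corrector, for `μ∞(f) = 0`). -/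
def Rhat (S : PathSDE d r₀ Ω P) (f : Seg d r₀ → ℝ) (ξ : Seg d r₀) : ℝ :=
  ∑' k : ℕ, S.Pt (k : ℝ) f ξ

/-- `φ̂_f(ξ) = E|f(ξ) + R̂_f(X_1^ξ) − R̂_f(ξ)|²`. -/
def phiHat (S : PathSDE d r₀ Ω P) (f : Seg d r₀ → ℝ) (ξ : Seg d r₀) : ℝ :=
  ∫ ω, (f ξ + Rhat S f (S.X ξ 1 ω) - Rhat S f ξ) ^ 2 ∂P

/-- `D̂_f = √(μ∞(φ̂_f))`. -/
def Dhat (S : PathSDE d r₀ Ω P) (μinf : Measure (Seg d r₀)) (f : Seg d r₀ → ℝ) : ℝ :=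
  Real.sqrt (∫ ξ, phiHat S f ξ ∂μinf)

/-- A martingale increment is orthogonal to every function measurable with respect to the past. -/
lemma integral_mul_martingale_increment [IsProbabilityMeasure P] {ℱ : Filtration ℝ mΩ}
    {m : ℝ → Ω → ℝ} (hm : Martingale m ℱ P) {s t : ℝ} (hst : s ≤ t) {f : Ω → ℝ}
    (hf : StronglyMeasurable[ℱ s] f) (ht : Integrable (fun ω => f ω * m t ω) P)
    (hs : Integrable (fun ω => f ω * m s ω) P) :
    ∫ ω, f ω * (m t ω - m s ω) ∂P = 0 := by
  have h1 : ∫ ω, f ω * m t ω ∂P = ∫ ω, f ω * m s ω ∂P := by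
    rw [← integral_condExp (ℱ.le s)]
    refine integral_congr_ae ?_
    have h2 := condExp_mul_of_stronglyMeasurable_left (m := ℱ s) (μ := P) (g := m t) hf ht
      (hm.integrable t)
    filter_upwards [h2, hm.condExp_ae_eq hst] with ω h3 h4
    have h5 : (P[fun ω => f ω * m t ω | ℱ s]) ω = (f * P[m t | ℱ s]) ω := h3
    rw [h5, Pi.mul_apply, h4]
  simp_rw [mul_sub]
  rw [integral_sub ht hs, h1, sub_self]

/-- A square-integrable martingale whose bracket grows at rate at most `K` has increments with
weighted second moment at most `K (t - s)`. -/
lemma integral_mul_sq_martingale_increment_le [IsProbabilityMeasure P] {ℱ : Filtration ℝ mΩ}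
    {m V : ℝ → Ω → ℝ} (hm : Martingale m ℱ P)
    (hmV : Martingale (fun t ω => m t ω * m t ω - V t ω) ℱ P) {K : ℝ}
    (hVb : ∀ t, 0 ≤ t → ∀ ω, |V t ω| ≤ K * t)
    (hV : ∀ s t, 0 ≤ s → s ≤ t → ∀ ω, V t ω - V s ω ≤ K * (t - s))
    {s t : ℝ} (hs : 0 ≤ s) (hst : s ≤ t) {ψ : Ω → ℝ} {B : ℝ}
    (hψ : StronglyMeasurable[ℱ s] ψ) (hψ0 : ∀ ω, 0 ≤ ψ ω) (hψB : ∀ ω, ψ ω ≤ B) :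
    Integrable (fun ω => ψ ω * (m t ω - m s ω) ^ 2) P ∧
      ∫ ω, ψ ω * (m t ω - m s ω) ^ 2 ∂P ≤ K * (t - s) * ∫ ω, ψ ω ∂P := by
  have hsm : ∀ r, AEStronglyMeasurable (m r) P := fun r => (hm.integrable r).1
  have hVI : ∀ r, 0 ≤ r → Integrable (V r) P := by
    intro r hr
    have h1 : AEStronglyMeasurable (V r) P := by
      have := ((hsm r).mul (hsm r)).sub (hmV.integrable r).1
      refine this.congr (ae_of_all _ fun ω => ?_)
      simp
    exact Integrable.of_bound h1 (K * r) (ae_of_all _ fun ω => by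
      rw [Real.norm_eq_abs]; exact hVb r hr ω)
  have hsq : ∀ r, 0 ≤ r → Integrable (fun ω => m r ω * m r ω) P := by
    intro r hr
    refine ((hmV.integrable r).add (hVI r hr)).congr (ae_of_all _ fun ω => ?_)
    simp
  have hL2 : ∀ r, 0 ≤ r → MemLp (m r) 2 P := by
    intro r hr
    rw [memLp_two_iff_integrable_sq (hsm r)]
    simpa [sq] using hsq r hr
  have hψm : AEStronglyMeasurable ψ P := (hψ.mono (ℱ.le s)).aestronglyMeasurable
  have hψn : ∀ᵐ ω ∂P, ‖ψ ω‖ ≤ B := ae_of_all _ fun ω => by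
    rw [Real.norm_eq_abs, abs_of_nonneg (hψ0 ω)]; exact hψB ω
  have ht : 0 ≤ t := hs.trans hst
  have bdd : ∀ {g : Ω → ℝ}, Integrable g P → Integrable (fun ω => ψ ω * g ω) P :=
    fun hg => hg.bdd_mul hψm hψn
  have hcross : ∫ ω, (ψ ω * m s ω) * (m t ω - m s ω) ∂P = 0 := by
    refine integral_mul_martingale_increment hm hst
      (hψ.mul (hm.1 s)) ?_ ?_
    · have := bdd ((hL2 s hs).integrable_mul (hL2 t ht))
      simpa [mul_assoc] using this
    · have := bdd (hsq s hs)
      simpa [mul_assoc] using this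
  have hbr := integral_mul_martingale_increment hmV hst hψ (bdd (hmV.integrable t))
    (bdd (hmV.integrable s))
  have hcI : Integrable (fun ω => (ψ ω * m s ω) * (m t ω - m s ω)) P := by
    have := bdd ((hL2 s hs).integrable_mul ((hL2 t ht).sub (hL2 s hs)))
    simpa [mul_assoc] using this
  have hbI : Integrable (fun ω => ψ ω * ((m t ω * m t ω - V t ω) - (m s ω * m s ω - V s ω))) P :=
    bdd ((hmV.integrable t).sub (hmV.integrable s))
  have hvI : Integrable (fun ω => ψ ω * (V t ω - V s ω)) P := bdd ((hVI t ht).sub (hVI s hs))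
  have hψI : Integrable ψ P := Integrable.of_bound hψm B hψn
  have hdecomp : ∀ ω, ψ ω * (m t ω - m s ω) ^ 2 =
      ψ ω * ((m t ω * m t ω - V t ω) - (m s ω * m s ω - V s ω)) + ψ ω * (V t ω - V s ω)
        - 2 * ((ψ ω * m s ω) * (m t ω - m s ω)) := fun ω => by ring
  refine ⟨bdd ((memLp_two_iff_integrable_sq ((hsm t).sub (hsm s))).1
    ((hL2 t ht).sub (hL2 s hs))), ?_⟩
  have hsI : Integrable (fun ω => ψ ω * ((m t ω * m t ω - V t ω) - (m s ω * m s ω - V s ω)) +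
      ψ ω * (V t ω - V s ω)) P := hbI.add hvI
  simp_rw [hdecomp]
  rw [integral_sub hsI (hcI.const_mul 2), integral_add hbI hvI, integral_const_mul,
    hcross, hbr]
  have : ∫ ω, ψ ω * (V t ω - V s ω) ∂P ≤ ∫ ω, (K * (t - s)) * ψ ω ∂P := by
    refine integral_mono hvI (hψI.const_mul _) fun ω => ?_
    have := mul_le_mul_of_nonneg_left (hV s t hs hst ω) (hψ0 ω)
    simpa [mul_comm] using this
  rw [integral_const_mul] at this
  linarith

/-- The running maximum of a sequence. -/
def runMax (W : ℕ → ℝ) : ℕ → ℝ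
  | 0 => W 0
  | i + 1 => max (runMax W i) (W (i + 1))

lemma le_runMax (W : ℕ → ℝ) {i n : ℕ} (h : i ≤ n) : W i ≤ runMax W n := by
  induction n, h using Nat.le_induction with
  | base => cases i with
    | zero => exact le_rfl
    | succ i => exact le_max_right _ _
  | succ n _ ih => exact ih.trans (le_max_left _ _)

/-- If `2 √w' ≤ √m + w' / √m` is applied along a nonnegative supermartingale started at `1`, the
square root of its running maximum has mean at most `2`. -/
lemma integral_sqrt_runMax_le [IsProbabilityMeasure P] {𝒢 : Filtration ℕ mΩ} {W : ℕ → Ω → ℝ}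
    (hW0 : ∀ ω, W 0 ω = 1) (hWm : ∀ i, StronglyMeasurable[𝒢 i] (W i))
    (hWnn : ∀ i ω, 0 ≤ W i ω) (hWI : ∀ i, Integrable (W i) P)
    (hstep : ∀ i (ψ : Ω → ℝ), StronglyMeasurable[𝒢 i] ψ → (∀ ω, 0 ≤ ψ ω) → (∀ ω, ψ ω ≤ 1) →
      ∫ ω, ψ ω * W (i + 1) ω ∂P ≤ ∫ ω, ψ ω * W i ω ∂P) (n : ℕ) :
    Measurable (fun ω => √(runMax (W · ω) n)) ∧
    Integrable (fun ω => √(runMax (W · ω) n)) P ∧ ∫ ω, √(runMax (W · ω) n) ∂P ≤ 2 := by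
  have hMm : ∀ i, StronglyMeasurable[𝒢 i] (fun ω => runMax (W · ω) i) := by
    intro i
    induction i with
    | zero => exact hWm 0
    | succ i ih =>
      exact ((ih.mono (𝒢.mono i.le_succ)).measurable.max (hWm (i + 1)).measurable).stronglyMeasurable
  have hM1 : ∀ i ω, 1 ≤ runMax (W · ω) i := fun i ω => by
    rw [← hW0 ω]; exact le_runMax (W · ω) i.zero_le
  have hMI : ∀ i, Integrable (fun ω => runMax (W · ω) i) P := by
    intro i
    induction i with
    | zero => exact hWI 0
    | succ i ih => exact ih.sup (hWI (i + 1))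
  have hsqm : ∀ i, Measurable[𝒢 i] (fun ω => √(runMax (W · ω) i)) := fun i =>
    (hMm i).measurable.sqrt
  have hsqI : ∀ i, Integrable (fun ω => √(runMax (W · ω) i)) P := by
    intro i
    refine (hMI i).mono' ((hsqm i).mono (𝒢.le i) le_rfl).aestronglyMeasurable
      (ae_of_all _ fun ω => ?_)
    rw [Real.norm_of_nonneg (Real.sqrt_nonneg _)]
    exact Real.sqrt_le_iff.2 ⟨by linarith [hM1 i ω], by nlinarith [hM1 i ω]⟩
  have hqm : ∀ i, StronglyMeasurable[𝒢 i] (fun ω => (√(runMax (W · ω) i))⁻¹) := fun i =>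
    (hsqm i).inv.stronglyMeasurable
  have hq0 : ∀ i ω, 0 ≤ (√(runMax (W · ω) i))⁻¹ := fun i ω => by positivity
  have hq1 : ∀ i ω, (√(runMax (W · ω) i))⁻¹ ≤ 1 := fun i ω =>
    inv_le_one_of_one_le₀ (Real.one_le_sqrt.2 (hM1 i ω))
  have hqI : ∀ i j, Integrable (fun ω => (√(runMax (W · ω) i))⁻¹ * W j ω) P := fun i j =>
    (hWI j).bdd_mul (c := 1) ((hqm i).mono (𝒢.le i)).aestronglyMeasurable
      (ae_of_all _ fun ω => by rw [Real.norm_of_nonneg (hq0 i ω)]; exact hq1 i ω)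
  have hmain : ∀ i, ∫ ω, (√(runMax (W · ω) i) + (√(runMax (W · ω) i))⁻¹ * W i ω) ∂P ≤ 2 := by
    intro i
    induction i with
    | zero => simp [runMax, hW0]; norm_num
    | succ i ih =>
      refine le_trans ?_ ih
      have h1 : ∫ ω, (√(runMax (W · ω) (i + 1)) +
          (√(runMax (W · ω) (i + 1)))⁻¹ * W (i + 1) ω) ∂P ≤
          ∫ ω, (√(runMax (W · ω) i) + (√(runMax (W · ω) i))⁻¹ * W (i + 1) ω) ∂P := by
        refine integral_mono ((hsqI _).add (hqI _ _)) ((hsqI _).add (hqI _ _)) fun ω => ?_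
        simp only [runMax]
        rcases le_total (W (i + 1) ω) (runMax (W · ω) i) with h | h
        · rw [max_eq_left h]
        · rw [max_eq_right h]
          have hm : 0 < √(runMax (W · ω) i) := Real.sqrt_pos.2 (by linarith [hM1 i ω])
          have hw : 0 < √(W (i + 1) ω) := Real.sqrt_pos.2 (by linarith [hM1 i ω])
          have hw2 : W (i + 1) ω = √(W (i + 1) ω) ^ 2 := (Real.sq_sqrt (hWnn _ _)).symm
          generalize √(runMax (W · ω) i) = x at *
          generalize √(W (i + 1) ω) = y at *
          rw [hw2]
          have h2 : y + y⁻¹ * y ^ 2 = 2 * y := by field_simp; ring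
          have h3 : x + x⁻¹ * y ^ 2 - 2 * y = x⁻¹ * (x - y) ^ 2 := by field_simp; ring
          have h4 : 0 ≤ x⁻¹ * (x - y) ^ 2 := by positivity
          linarith
      refine h1.trans ?_
      rw [integral_add (hsqI _) (hqI _ _), integral_add (hsqI _) (hqI _ _)]
      exact add_le_add le_rfl (hstep i _ (hqm i) (hq0 i) (hq1 i))
  refine ⟨(hsqm n).mono (𝒢.le n) le_rfl, hsqI n, le_trans ?_ (hmain n)⟩
  refine integral_mono (hsqI _) ((hsqI _).add (hqI _ _)) fun ω => ?_
  have := mul_nonneg (hq0 n ω) (hWnn n ω)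
  simpa using this

/-- The rate at which the exponent has to be compensated at position `y`. -/
def compRate {d : ℕ} (κ α : ℝ) (y : EucSp d) : ℝ := κ * (α + α ^ 2 * (8 * ‖y‖ ^ 2 + 2))

/-- One step of the discretised exponential supermartingale, cut off when the increment `Δ` or
the position `y` is too large. -/
def stepFactor {d : ℕ} (κ α h R : ℝ) (p : EucSp d × EucSp d) : ℝ :=
  if ‖p.1‖ ≤ R ∧ ‖p.2‖ ≤ 1 ∧ α * (2 * ‖p.1‖ * ‖p.2‖ + ‖p.2‖ ^ 2) ≤ 1 then
    Real.exp (α * (2 * ⟪p.1, p.2⟫ + ‖p.2‖ ^ 2) - h * compRate κ α p.1) else 0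

lemma compRate_nonneg {κ α : ℝ} (hκ : 0 ≤ κ) (hα : 0 ≤ α) (y : EucSp d) :
    0 ≤ compRate κ α y := by
  unfold compRate; positivity

lemma continuous_compRate (κ α : ℝ) : Continuous (compRate (d := d) κ α) := by
  unfold compRate; fun_prop

lemma measurable_stepFactor (κ α h R : ℝ) : Measurable (stepFactor (d := d) κ α h R) := by
  unfold stepFactor
  refine Measurable.ite ?_ ?_ measurable_const
  · refine ((isClosed_le (f := fun p : EucSp d × EucSp d => ‖p.1‖) (g := fun _ => R)
      (by fun_prop) (by fun_prop)).inter ((isClosed_le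
      (f := fun p : EucSp d × EucSp d => ‖p.2‖) (g := fun _ => 1) (by fun_prop)
      (by fun_prop)).inter (isClosed_le
      (f := fun p : EucSp d × EucSp d => α * (2 * ‖p.1‖ * ‖p.2‖ + ‖p.2‖ ^ 2)) (g := fun _ => 1)
      (by fun_prop) (by fun_prop)))).measurableSet
  · refine Continuous.measurable ?_
    have := continuous_compRate (d := d) κ α
    fun_prop

lemma stepFactor_nonneg (κ α h R : ℝ) (p : EucSp d × EucSp d) : 0 ≤ stepFactor κ α h R p := by
  unfold stepFactor; split_ifs <;> positivity

lemma abs_exponent_le {α : ℝ} (hα : 0 ≤ α) (y Δ : EucSp d) :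
    |α * (2 * ⟪y, Δ⟫ + ‖Δ‖ ^ 2)| ≤ α * (2 * ‖y‖ * ‖Δ‖ + ‖Δ‖ ^ 2) := by
  rw [abs_mul, abs_of_nonneg hα]
  refine mul_le_mul_of_nonneg_left ?_ hα
  have h := abs_real_inner_le_norm y Δ
  calc |2 * ⟪y, Δ⟫ + ‖Δ‖ ^ 2| ≤ |2 * ⟪y, Δ⟫| + |‖Δ‖ ^ 2| := abs_add_le _ _
    _ ≤ 2 * ‖y‖ * ‖Δ‖ + ‖Δ‖ ^ 2 := by
      rw [abs_mul, abs_of_nonneg (sq_nonneg ‖Δ‖), abs_two]; linarith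

lemma stepFactor_le_exp_one {κ α h R : ℝ} (hκ : 0 ≤ κ) (hα : 0 ≤ α) (hh : 0 ≤ h)
    (p : EucSp d × EucSp d) : stepFactor κ α h R p ≤ Real.exp 1 := by
  unfold stepFactor
  split_ifs with hp
  · refine Real.exp_le_exp.2 ?_
    have h1 := (le_abs_self _).trans ((abs_exponent_le hα p.1 p.2).trans hp.2.2)
    have h2 := mul_nonneg hh (compRate_nonneg hκ hα p.1)
    linarith
  · positivity

lemma stepFactor_le {κ α h R : ℝ} (hα : 0 ≤ α) (y Δ : EucSp d) :
    stepFactor κ α h R (y, Δ) ≤ (if ‖y‖ ≤ R then Real.exp (-(h * compRate κ α y)) else 0) *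
      (1 + 2 * α * ⟪y, Δ⟫ + (α + α ^ 2 * (8 * ‖y‖ ^ 2 + 2)) * ‖Δ‖ ^ 2) := by
  have hcs := abs_real_inner_le_norm y Δ
  have hin : ⟪y, Δ⟫ ^ 2 ≤ ‖y‖ ^ 2 * ‖Δ‖ ^ 2 := by
    rw [← sq_abs, ← mul_pow]; exact pow_le_pow_left₀ (abs_nonneg _) hcs 2
  have hpos : 0 ≤ 1 + 2 * α * ⟪y, Δ⟫ + (α + α ^ 2 * (8 * ‖y‖ ^ 2 + 2)) * ‖Δ‖ ^ 2 := by
    have h1 : 0 ≤ α * ‖Δ‖ ^ 2 := by positivity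
    have h2 : 0 ≤ α ^ 2 * ‖Δ‖ ^ 2 := by positivity
    have h3 : 0 ≤ α ^ 2 * (‖y‖ ^ 2 * ‖Δ‖ ^ 2) := by positivity
    have h4 : α ^ 2 * ⟪y, Δ⟫ ^ 2 ≤ α ^ 2 * (‖y‖ ^ 2 * ‖Δ‖ ^ 2) := by gcongr
    nlinarith [sq_nonneg (1 + α * ⟪y, Δ⟫)]
  unfold stepFactor
  split_ifs with hp hy hy
  · rw [sub_eq_neg_add, Real.exp_add]
    refine mul_le_mul_of_nonneg_left ?_ (Real.exp_pos _).le
    simp only at hp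
    have hx := (abs_exponent_le hα y Δ).trans hp.2.2
    have he := (abs_le.1 (Real.abs_exp_sub_one_sub_id_le hx)).2
    have hsq : (2 * ⟪y, Δ⟫ + ‖Δ‖ ^ 2) ^ 2 ≤ (8 * ‖y‖ ^ 2 + 2) * ‖Δ‖ ^ 2 := by
      have h5 : ‖Δ‖ ^ 2 * ‖Δ‖ ^ 2 ≤ 1 * ‖Δ‖ ^ 2 :=
        mul_le_mul_of_nonneg_right (pow_le_one₀ (norm_nonneg _) hp.2.1) (sq_nonneg _)
      nlinarith [sq_nonneg (2 * ⟪y, Δ⟫ - ‖Δ‖ ^ 2)]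
    have := mul_le_mul_of_nonneg_left hsq (sq_nonneg α)
    nlinarith
  · exact absurd hp.1 hy
  · exact mul_nonneg (Real.exp_pos _).le hpos
  · simp

/-- The one-step supermartingale inequality. -/
lemma integral_mul_stepFactor_le [IsProbabilityMeasure P] {m : MeasurableSpace Ω} (hm : m ≤ mΩ)
    {κ α h R : ℝ} (hκ : 0 ≤ κ) (hα : 0 ≤ α) (hh : 0 ≤ h) {y Δ : Ω → EucSp d}
    (hy : StronglyMeasurable[m] y)
    (h1 : ∀ f : Ω → EucSp d, StronglyMeasurable[m] f → (∃ B, ∀ ω, ‖f ω‖ ≤ B) →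
      Integrable (fun ω => ⟪f ω, Δ ω⟫) P ∧ ∫ ω, ⟪f ω, Δ ω⟫ ∂P = 0)
    (h2 : ∀ ψ : Ω → ℝ, StronglyMeasurable[m] ψ → (∀ ω, 0 ≤ ψ ω) → (∃ B, ∀ ω, ψ ω ≤ B) →
      Integrable (fun ω => ψ ω * ‖Δ ω‖ ^ 2) P ∧
        ∫ ω, ψ ω * ‖Δ ω‖ ^ 2 ∂P ≤ κ * h * ∫ ω, ψ ω ∂P)
    {ψ : Ω → ℝ} (hψ : StronglyMeasurable[m] ψ) (hψ0 : ∀ ω, 0 ≤ ψ ω) {B : ℝ}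
    (hψB : ∀ ω, ψ ω ≤ B) :
    ∫ ω, ψ ω * stepFactor κ α h R (y ω, Δ ω) ∂P ≤ ∫ ω, ψ ω ∂P := by
  set χ : EucSp d → ℝ := fun y => if ‖y‖ ≤ R then Real.exp (-(h * compRate κ α y)) else 0 with hχ
  set g : EucSp d → ℝ := fun y => α + α ^ 2 * (8 * ‖y‖ ^ 2 + 2) with hg
  have hχm : Measurable χ := by
    refine Measurable.ite (isClosed_le continuous_norm continuous_const).measurableSet ?_
      measurable_const
    have := continuous_compRate (d := d) κ α
    exact Continuous.measurable (by fun_prop)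
  have hgm : Measurable g := Continuous.measurable (by fun_prop)
  have hχ0 : ∀ z, 0 ≤ χ z := fun z => by simp only [hχ]; split_ifs <;> positivity
  have hχ1 : ∀ z, χ z ≤ 1 := fun z => by
    simp only [hχ]; split_ifs
    · exact Real.exp_le_one_iff.2 (neg_nonpos.2 (mul_nonneg hh (compRate_nonneg hκ hα z)))
    · exact zero_le_one
  have hg0 : ∀ z, 0 ≤ g z := fun z => by simp only [hg]; positivity
  have hχR : ∀ z, χ z * ‖z‖ ≤ |R| := fun z => by
    by_cases hz : ‖z‖ ≤ R
    · calc χ z * ‖z‖ ≤ 1 * ‖z‖ := mul_le_mul_of_nonneg_right (hχ1 z) (norm_nonneg _)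
        _ ≤ |R| := by rw [one_mul]; exact hz.trans (le_abs_self R)
    · simp only [hχ, if_neg hz, zero_mul]; positivity
  have hχg : ∀ z, χ z * g z ≤ α + α ^ 2 * (8 * R ^ 2 + 2) := fun z => by
    by_cases hz : ‖z‖ ≤ R
    · calc χ z * g z ≤ 1 * g z := mul_le_mul_of_nonneg_right (hχ1 z) (hg0 z)
        _ ≤ α + α ^ 2 * (8 * R ^ 2 + 2) := by rw [one_mul]; simp only [hg]; gcongr
    · simp only [hχ, if_neg hz, zero_mul]; positivity
  have hB : 0 ≤ B := by
    obtain ⟨ω⟩ : Nonempty Ω := nonempty_of_isProbabilityMeasure P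
    exact (hψ0 ω).trans (hψB ω)
  have hψm : Measurable[m] ψ := hψ.measurable
  have hym : Measurable[m] y := hy.measurable
  have hχy : Measurable[m] (fun ω => χ (y ω)) := hχm.comp hym
  have hgy : Measurable[m] (fun ω => g (y ω)) := hgm.comp hym
  have hφm : StronglyMeasurable[m] (fun ω => ψ ω * χ (y ω)) := (hψm.mul hχy).stronglyMeasurable
  have hφ0 : ∀ ω, 0 ≤ ψ ω * χ (y ω) := fun ω => mul_nonneg (hψ0 ω) (hχ0 _)
  have hφB : ∀ ω, ψ ω * χ (y ω) ≤ B := fun ω =>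
    (mul_le_mul (hψB ω) (hχ1 _) (hχ0 _) hB).trans_eq (mul_one B)
  have hφgm : StronglyMeasurable[m] (fun ω => ψ ω * χ (y ω) * g (y ω)) :=
    ((hψm.mul hχy).mul hgy).stronglyMeasurable
  have hφg0 : ∀ ω, 0 ≤ ψ ω * χ (y ω) * g (y ω) := fun ω => mul_nonneg (hφ0 ω) (hg0 _)
  have hφgB : ∀ ω, ψ ω * χ (y ω) * g (y ω) ≤ B * (α + α ^ 2 * (8 * R ^ 2 + 2)) := fun ω => by
    rw [mul_assoc]
    exact mul_le_mul (hψB ω) (hχg _) (mul_nonneg (hχ0 _) (hg0 _)) hB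
  have h_int : ∀ {f : Ω → ℝ} {C : ℝ}, StronglyMeasurable[m] f → (∀ ω, 0 ≤ f ω) →
      (∀ ω, f ω ≤ C) → Integrable f P := fun {f C} hf h0 hC =>
    Integrable.of_bound (hf.mono hm).aestronglyMeasurable C (ae_of_all _ fun ω => by
      rw [Real.norm_of_nonneg (h0 ω)]; exact hC ω)
  obtain ⟨hl1, hl2⟩ := h1 (fun ω => (ψ ω * χ (y ω)) • y ω) (hφm.smul hy)
    ⟨B * |R|, fun ω => by
      rw [norm_smul, Real.norm_of_nonneg (hφ0 ω), mul_assoc]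
      exact mul_le_mul (hψB ω) (hχR _) (mul_nonneg (hχ0 _) (norm_nonneg _)) hB⟩
  obtain ⟨hq1, hq2⟩ := h2 _ hφgm hφg0 ⟨_, hφgB⟩
  have hφI := h_int hφm hφ0 hφB
  have hφgI := h_int hφgm hφg0 hφgB
  have hψI := h_int hψ hψ0 hψB
  have hsI : Integrable (fun ω => ψ ω * χ (y ω) + 2 * α * ⟪(ψ ω * χ (y ω)) • y ω, Δ ω⟫) P :=
    hφI.add (hl1.const_mul _)
  calc ∫ ω, ψ ω * stepFactor κ α h R (y ω, Δ ω) ∂P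
      ≤ ∫ ω, (ψ ω * χ (y ω) + 2 * α * ⟪(ψ ω * χ (y ω)) • y ω, Δ ω⟫ +
          ψ ω * χ (y ω) * g (y ω) * ‖Δ ω‖ ^ 2) ∂P := by
        refine integral_mono_of_nonneg
          (ae_of_all _ fun ω => mul_nonneg (hψ0 ω) (stepFactor_nonneg _ _ _ _ _))
          (hsI.add hq1) (ae_of_all _ fun ω => ?_)
        refine (mul_le_mul_of_nonneg_left (stepFactor_le hα (y ω) (Δ ω)) (hψ0 ω)).trans_eq ?_
        simp only [hχ, hg, real_inner_smul_left]
        ring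
    _ ≤ ∫ ω, ψ ω * χ (y ω) ∂P + κ * h * ∫ ω, ψ ω * χ (y ω) * g (y ω) ∂P := by
        rw [integral_add hsI hq1, integral_add hφI (hl1.const_mul _), integral_const_mul, hl2]
        linarith
    _ = ∫ ω, (ψ ω * χ (y ω) + κ * h * (ψ ω * χ (y ω) * g (y ω))) ∂P := by
        rw [integral_add hφI (hφgI.const_mul _), integral_const_mul]
    _ ≤ ∫ ω, ψ ω ∂P := by
        refine integral_mono (hφI.add (hφgI.const_mul _)) hψI fun ω => ?_
        have h3 : χ (y ω) * (1 + h * compRate κ α (y ω)) ≤ 1 := by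
          simp only [hχ]; split_ifs
          · have h4 := Real.add_one_le_exp (h * compRate κ α (y ω))
            rw [Real.exp_neg, inv_mul_le_one₀ (Real.exp_pos _)]
            linarith
          · simp
        calc ψ ω * χ (y ω) + κ * h * (ψ ω * χ (y ω) * g (y ω))
            = ψ ω * (χ (y ω) * (1 + h * compRate κ α (y ω))) := by
              simp only [compRate, hg]; ring
          _ ≤ ψ ω := mul_le_of_le_one_right (hψ0 ω) h3

/-- `N` has centred increments whose conditional second moments grow at rate at most `κ`. -/
structure NoiseBound (ℱ : Filtration ℝ mΩ) (P : Measure Ω) (κ : ℝ) (N : ℝ → Ω → EucSp d) :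
    Prop where
  meas : ∀ t, 0 ≤ t → StronglyMeasurable[ℱ t] (N t)
  centred : ∀ s t, 0 ≤ s → s ≤ t → ∀ f : Ω → EucSp d, StronglyMeasurable[ℱ s] f →
    (∃ B, ∀ ω, ‖f ω‖ ≤ B) → Integrable (fun ω => ⟪f ω, N t ω - N s ω⟫) P ∧
      ∫ ω, ⟪f ω, N t ω - N s ω⟫ ∂P = 0
  quad : ∀ s t, 0 ≤ s → s ≤ t → ∀ ψ : Ω → ℝ, StronglyMeasurable[ℱ s] ψ → (∀ ω, 0 ≤ ψ ω) →
    (∃ B, ∀ ω, ψ ω ≤ B) → Integrable (fun ω => ψ ω * ‖N t ω - N s ω‖ ^ 2) P ∧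
      ∫ ω, ψ ω * ‖N t ω - N s ω‖ ^ 2 ∂P ≤ κ * (t - s) * ∫ ω, ψ ω ∂P

/-- The discretised exponential supermartingale along the paths `Y` and `N` with mesh `h`. -/
def gridW {d : ℕ} (κ a l h R : ℝ) (Y N : ℝ → EucSp d) : ℕ → ℝ
  | 0 => 1
  | i + 1 => gridW κ a l h R Y N i *
      stepFactor κ (a * Real.exp (l * (((i + 1 : ℕ) : ℝ) * h))) h R
        (Y ((i : ℝ) * h), N (((i + 1 : ℕ) : ℝ) * h) - N ((i : ℝ) * h))

lemma integral_sqrt_runMax_gridW_le [IsProbabilityMeasure P] {ℱ : Filtration ℝ mΩ}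
    {κ a l h R : ℝ} (hκ : 0 ≤ κ) (ha : 0 ≤ a) (hh : 0 ≤ h) {Y N : ℝ → Ω → EucSp d}
    (hY : ∀ t, 0 ≤ t → StronglyMeasurable[ℱ t] (Y t)) (hN : NoiseBound ℱ P κ N) (n : ℕ) :
    Measurable (fun ω => √(runMax (gridW κ a l h R (Y · ω) (N · ω)) n)) ∧
    Integrable (fun ω => √(runMax (gridW κ a l h R (Y · ω) (N · ω)) n)) P ∧
      ∫ ω, √(runMax (gridW κ a l h R (Y · ω) (N · ω)) n) ∂P ≤ 2 := by
  have hmono : Monotone (fun i : ℕ => (i : ℝ) * h) := fun i j hij => by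
    simp only; gcongr
  have ht0 : ∀ i : ℕ, 0 ≤ (i : ℝ) * h := fun i => by positivity
  let 𝒢 : Filtration ℕ mΩ := ⟨fun i => ℱ ((i : ℝ) * h), fun i j hij => ℱ.mono (hmono hij),
    fun i => ℱ.le _⟩
  set W : ℕ → Ω → ℝ := fun i ω => gridW κ a l h R (Y · ω) (N · ω) i with hW
  have hWnn : ∀ i ω, 0 ≤ W i ω := by
    intro i ω
    induction i with
    | zero => simp [hW, gridW]
    | succ i ih => exact mul_nonneg ih (stepFactor_nonneg _ _ _ _ _)
  have hWb : ∀ i ω, W i ω ≤ Real.exp 1 ^ i := by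
    intro i ω
    induction i with
    | zero => simp [hW, gridW]
    | succ i ih =>
      rw [pow_succ]
      exact mul_le_mul ih (stepFactor_le_exp_one hκ (by positivity) hh _)
        (stepFactor_nonneg _ _ _ _ _) (by positivity)
  have hWm : ∀ i, StronglyMeasurable[𝒢 i] (W i) := by
    intro i
    induction i with
    | zero => exact stronglyMeasurable_const
    | succ i ih =>
      have h1 : Measurable[𝒢 (i + 1)] (W i) := (ih.mono (𝒢.mono i.le_succ)).measurable
      have h2 : Measurable[𝒢 (i + 1)] (Y ((i : ℝ) * h)) :=
        ((hY _ (ht0 i)).mono (𝒢.mono i.le_succ)).measurable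
      have h3 : StronglyMeasurable[𝒢 (i + 1)] (N ((i : ℝ) * h)) :=
        (hN.meas _ (ht0 i)).mono (𝒢.mono i.le_succ)
      have h4 : StronglyMeasurable[𝒢 (i + 1)] (N (((i + 1 : ℕ) : ℝ) * h)) :=
        hN.meas _ (ht0 (i + 1))
      have h5 : Measurable[𝒢 (i + 1)] (fun ω => N (((i + 1 : ℕ) : ℝ) * h) ω - N ((i : ℝ) * h) ω) :=
        (h4.sub h3).measurable
      exact (h1.mul ((measurable_stepFactor _ _ _ _).comp (h2.prodMk h5))).stronglyMeasurable
  have hWI : ∀ i, Integrable (W i) P := fun i =>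
    Integrable.of_bound ((hWm i).mono (𝒢.le i)).aestronglyMeasurable (Real.exp 1 ^ i)
      (ae_of_all _ fun ω => by rw [Real.norm_of_nonneg (hWnn i ω)]; exact hWb i ω)
  refine integral_sqrt_runMax_le (𝒢 := 𝒢) (W := W) (fun ω => rfl) hWm hWnn hWI ?_ n
  intro i ψ hψ hψ0 hψ1
  have hle : (i : ℝ) * h ≤ ((i + 1 : ℕ) : ℝ) * h := hmono i.le_succ
  have hinc : ((i + 1 : ℕ) : ℝ) * h - (i : ℝ) * h = h := by push_cast; ring
  have hquad := hN.quad _ _ (ht0 i) hle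
  rw [hinc] at hquad
  have := integral_mul_stepFactor_le (R := R) (𝒢.le i) hκ
    (α := a * Real.exp (l * (((i + 1 : ℕ) : ℝ) * h))) (by positivity) hh (hY _ (ht0 i))
    (hN.centred _ _ (ht0 i) hle) hquad (ψ := fun ω => ψ ω * W i ω)
    (hψ.mul (hWm i)) (fun ω => mul_nonneg (hψ0 ω) (hWnn i ω)) (B := 1 * Real.exp 1 ^ i)
    (fun ω => mul_le_mul (hψ1 ω) (hWb i ω) (hWnn i ω) zero_le_one)
  simpa only [hW, gridW, mul_assoc] using this

/-- The noise part of the solution. -/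
def PathSDE.noise (S : PathSDE d r₀ Ω P) (ξ : Seg d r₀) (t : ℝ) (ω : Ω) : EucSp d :=
  S.Y ξ ω t - ev0 S.hr₀ ξ - ∫ s in (0:ℝ)..t, S.b (S.X ξ s ω)

lemma PathSDE.continuousOn_X (S : PathSDE d r₀ Ω P) (ξ : Seg d r₀) (ω : Ω) :
    ContinuousOn (fun t => S.X ξ t ω) (Set.Ici 0) := by
  rw [continuousOn_iff_continuous_domRestrict]
  refine ContinuousMap.continuous_of_continuous_uncurry _ ?_
  have h : Function.uncurry (fun (x : Set.Ici (0:ℝ)) (y : Set.Icc (-r₀) (0:ℝ)) =>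
      (Set.domRestrict (Set.Ici 0) (fun t => S.X ξ t ω) x) y) =
      fun p => S.Y ξ ω (p.1.1 + p.2.1) := by
    ext1 p
    exact S.hX ξ p.1.1 p.1.2 ω p.2
  rw [h]
  exact (S.hYcont ξ ω).comp (by fun_prop)

lemma PathSDE.continuousOn_b (S : PathSDE d r₀ Ω P) (ξ : Seg d r₀) (ω : Ω) :
    ContinuousOn (fun t => S.b (S.X ξ t ω)) (Set.Ici 0) :=
  S.hA1bcont.comp_continuousOn (S.continuousOn_X ξ ω)

lemma ContinuousOn.intervalIntegrable_of_Ici {E : Type*} [NormedAddCommGroup E] {f : ℝ → E}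
    (hf : ContinuousOn f (Set.Ici 0)) {s t : ℝ} (hs : 0 ≤ s) (ht : 0 ≤ t) :
    IntervalIntegrable f volume s t :=
  (hf.mono fun _ hx => (le_min hs ht).trans hx.1).intervalIntegrable

lemma PathSDE.ev0_X (S : PathSDE d r₀ Ω P) (ξ : Seg d r₀) {t : ℝ} (ht : 0 ≤ t) (ω : Ω) :
    ev0 S.hr₀ (S.X ξ t ω) = S.Y ξ ω t := by
  rw [ev0, S.hX ξ t ht ω]; simp

lemma PathSDE.Y_meas (S : PathSDE d r₀ Ω P) (ξ : Seg d r₀) {t : ℝ} (ht : 0 ≤ t) :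
    StronglyMeasurable[S.ℱ t] (fun ω => S.Y ξ ω t) := by
  have h : Continuous (fun ζ : Seg d r₀ => ev0 S.hr₀ ζ) := by
    unfold ev0; fun_prop
  have := h.comp_stronglyMeasurable (S.hXadapted ξ t ht)
  simpa only [S.ev0_X ξ ht] using this

lemma PathSDE.inner_noise (S : PathSDE d r₀ Ω P) (ξ : Seg d r₀) {t : ℝ} (ht : 0 ≤ t) (ω : Ω)
    (u : EucSp d) : ⟪u, S.noise ξ t ω⟫ = ⟪u, S.Y ξ ω (max t 0)⟫ - ⟪u, ev0 S.hr₀ ξ⟫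
        - ∫ s in (0:ℝ)..(max t 0), ⟪u, S.b (S.X ξ s ω)⟫ := by
  rw [max_eq_left ht, PathSDE.noise, inner_sub_right, inner_sub_right]
  have hI := (S.continuousOn_b ξ ω).intervalIntegrable_of_Ici le_rfl ht
  rw [intervalIntegral.integral_of_le ht, intervalIntegral.integral_of_le ht, integral_inner]
  exact (intervalIntegrable_iff_integrableOn_Ioc_of_le ht).1 hI

lemma PathSDE.exists_noiseBound (S : PathSDE d r₀ Ω P) :
    ∃ κ, 0 ≤ κ ∧ ∀ ξ, NoiseBound S.ℱ P κ (S.noise ξ) := by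
  have := S.hP
  obtain ⟨C, hC⟩ := S.hA3
  have hσ : ∀ ζ, ‖S.σ ζ‖ ≤ C := fun ζ => by linarith [hC ζ, norm_nonneg (S.σinv ζ)]
  refine ⟨d * C ^ 2, by positivity, fun ξ => ?_⟩
  let e : Fin d → EucSp d := fun i => EuclideanSpace.single i 1
  have hcoord : ∀ (i : Fin d) (x : EucSp d), ⟪e i, x⟫ = x i := fun i x => by
    simp [e, EuclideanSpace.inner_single_left]
  set m : Fin d → ℝ → Ω → ℝ := fun i t ω => ⟪e i, S.Y ξ ω (max t 0)⟫ - ⟪e i, ev0 S.hr₀ ξ⟫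
        - ∫ s in (0:ℝ)..(max t 0), ⟪e i, S.b (S.X ξ s ω)⟫ with hm
  have hmN : ∀ i t, 0 ≤ t → ∀ ω, m i t ω = S.noise ξ t ω i := fun i t ht ω => by
    rw [← hcoord, S.inner_noise ξ ht]
  have hmart : ∀ i, Martingale (m i) S.ℱ P := fun i => S.hSDE₁ ξ (e i)
  set v : Fin d → Ω → ℝ → ℝ := fun i ω s =>
    ⟪(ContinuousLinearMap.adjoint (S.σ (S.X ξ s ω))) (e i),
      (ContinuousLinearMap.adjoint (S.σ (S.X ξ s ω))) (e i)⟫ with hv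
  have hv0 : ∀ i ω s, 0 ≤ v i ω s := fun i ω s => real_inner_self_nonneg
  have hvC : ∀ i ω s, v i ω s ≤ C ^ 2 := fun i ω s => by
    simp only [hv, real_inner_self_eq_norm_sq]
    refine pow_le_pow_left₀ (norm_nonneg _) ?_ 2
    refine (ContinuousLinearMap.le_opNorm _ _).trans ?_
    rw [LinearIsometryEquiv.norm_map]
    simpa [e] using hσ _
  have hvc : ∀ i ω, ContinuousOn (v i ω) (Set.Ici 0) := fun i ω => by
    obtain ⟨L, hL⟩ := S.hA1σ
    have h1 : ContinuousOn (fun s => (ContinuousLinearMap.adjoint (S.σ (S.X ξ s ω))) (e i))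
        (Set.Ici 0) :=
      (((ContinuousLinearMap.adjoint (𝕜 := ℝ) (E := EucSp d) (F := EucSp d)).continuous.comp
        hL.continuous).clm_apply continuous_const).comp_continuousOn (S.continuousOn_X ξ ω)
    exact h1.inner h1
  set V : Fin d → ℝ → Ω → ℝ := fun i t ω => ∫ s in (0:ℝ)..(max t 0), v i ω s with hV
  have hmart2 : ∀ i, Martingale (fun t ω => m i t ω * m i t ω - V i t ω) S.ℱ P :=
    fun i => S.hSDE₂ ξ (e i) (e i)
  have hVinc : ∀ i s t, 0 ≤ s → s ≤ t → ∀ ω, V i t ω - V i s ω ≤ C ^ 2 * (t - s) := by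
    intro i s t hs hst ω
    have ht := hs.trans hst
    simp only [hV, max_eq_left hs, max_eq_left ht]
    rw [intervalIntegral.integral_interval_sub_left
      ((hvc i ω).intervalIntegrable_of_Ici le_rfl ht)
      ((hvc i ω).intervalIntegrable_of_Ici le_rfl hs)]
    have := intervalIntegral.integral_mono_on hst
      ((hvc i ω).intervalIntegrable_of_Ici hs ht)
      (intervalIntegrable_const (c := C ^ 2)) (fun s _ => hvC i ω s)
    simpa [mul_comm] using this
  have hVb : ∀ i t, 0 ≤ t → ∀ ω, |V i t ω| ≤ C ^ 2 * t := by
    intro i t ht ω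
    have h0 : V i 0 ω = 0 := by simp [hV]
    have h1 : 0 ≤ V i t ω := by
      simp only [hV, max_eq_left ht]
      exact intervalIntegral.integral_nonneg ht fun s _ => hv0 i ω s
    rw [abs_of_nonneg h1]
    simpa [h0] using hVinc i 0 t le_rfl ht ω
  refine ⟨fun t ht => ?_, fun s t hs hst f hf hfB => ?_, fun s t hs hst ψ hψ hψ0 hψB => ?_⟩
  · have h1 : Measurable[S.ℱ t] (fun ω => (fun i => m i t ω : Fin d → ℝ)) :=
      @measurable_pi_lambda _ _ _ (S.ℱ t) _ _ (fun i => ((hmart i).1 t).measurable)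
    have h2 : Measurable[S.ℱ t] (S.noise ξ t) := by
      have h3 := (PiLp.continuous_toLp 2 (fun _ : Fin d => ℝ)).measurable.comp h1
      convert h3 using 1
      ext ω i
      exact (hmN i t ht ω).symm
    exact h2.stronglyMeasurable
  · obtain ⟨B, hB⟩ := hfB
    have ht := hs.trans hst
    have hfi : ∀ i, StronglyMeasurable[S.ℱ s] (fun ω => f ω i) := fun i =>
      (EuclideanSpace.proj (𝕜 := ℝ) i).continuous.comp_stronglyMeasurable hf
    have hfI : ∀ i r, Integrable (fun ω => f ω i * m i r ω) P := fun i r =>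
      ((hmart i).integrable r).bdd_mul (c := B) ((hfi i).mono (S.ℱ.le s)).aestronglyMeasurable
        (ae_of_all _ fun ω => (PiLp.norm_apply_le (f ω) i).trans (hB ω))
    have heq : (fun ω => ⟪f ω, S.noise ξ t ω - S.noise ξ s ω⟫) =
        fun ω => ∑ i, f ω i * (m i t ω - m i s ω) := by
      ext ω
      rw [PiLp.inner_apply]
      refine Finset.sum_congr rfl fun i _ => ?_
      rw [hmN i t ht, hmN i s hs]
      simp [mul_comm]
    have hI : ∀ i, Integrable (fun ω => f ω i * (m i t ω - m i s ω)) P := fun i => by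
      simp only [mul_sub]
      exact (hfI i t).sub (hfI i s)
    rw [heq]
    refine ⟨integrable_finsetSum _ fun i _ => hI i, ?_⟩
    rw [integral_finsetSum _ fun i _ => hI i]
    exact Finset.sum_eq_zero fun i _ =>
      integral_mul_martingale_increment (hmart i) hst (hfi i) (hfI i t) (hfI i s)
  · obtain ⟨B, hB⟩ := hψB
    have ht := hs.trans hst
    have hkey := fun i => integral_mul_sq_martingale_increment_le (hmart i) (hmart2 i) (hVb i)
      (hVinc i) hs hst hψ hψ0 hB
    have heq : (fun ω => ψ ω * ‖S.noise ξ t ω - S.noise ξ s ω‖ ^ 2) =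
        fun ω => ∑ i, ψ ω * (m i t ω - m i s ω) ^ 2 := by
      ext ω
      rw [EuclideanSpace.norm_sq_eq, Finset.mul_sum]
      refine Finset.sum_congr rfl fun i _ => ?_
      rw [hmN i t ht, hmN i s hs]
      simp
    rw [heq]
    refine ⟨integrable_finsetSum _ fun i _ => (hkey i).1, ?_⟩
    rw [integral_finsetSum _ fun i _ => (hkey i).1]
    refine (Finset.sum_le_sum fun i _ => (hkey i).2).trans_eq ?_
    simp; ring

/-- The weighted energy `a e^{lt} |Y_t|²` minus the part of its drift that is controlled by `p`. -/
def energy {d : ℕ} (a l C c : ℝ) (Y : ℝ → EucSp d) (p : ℝ → ℝ) (t : ℝ) : ℝ :=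
  a * Real.exp (l * t) * ‖Y t‖ ^ 2 - ∫ s in (0:ℝ)..t, a * Real.exp (l * s) * (C + c * p s)

/-- Up to an error `ε (t - s)`, increments of the energy over short intervals are bounded by the
compensated noise increments. -/
lemma exists_energy_increment_le {κ a l C c T : ℝ} {Y N β : ℝ → EucSp d} {p : ℝ → ℝ}
    (hY : ContinuousOn Y (Ici 0)) (hN : ContinuousOn N (Ici 0)) (hβ : ContinuousOn β (Ici 0))
    (hp : ContinuousOn p (Ici 0))
    (hNY : ∀ s t, 0 ≤ s → s ≤ t → Y t = Y s + (N t - N s) + ∫ v in s..t, β v)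
    (hdiag : ∀ v ∈ Icc 0 T, a * Real.exp (l * v) * (l * ‖Y v‖ ^ 2 + 2 * ⟪Y v, β v⟫ - C - c * p v)
      + compRate κ (a * Real.exp (l * v)) (Y v) ≤ 0) {ε : ℝ} (hε : 0 < ε) :
    ∃ η > 0, ∀ s t, 0 ≤ s → s ≤ t → t ≤ T → t - s < η →
      energy a l C c Y p t - energy a l C c Y p s ≤
        a * Real.exp (l * t) * (2 * ⟪Y s, N t - N s⟫ + ‖N t - N s‖ ^ 2)
          - (t - s) * compRate κ (a * Real.exp (l * t)) (Y s) + ε * (t - s) := by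
  set ρ : ℝ × ℝ × ℝ → ℝ := fun q =>
    a * Real.exp (l * q.2.1) * ⟪Y q.1 + Y q.2.1 + (N q.2.1 - N q.1), β q.2.2⟫
      + a * ‖Y q.1‖ ^ 2 * (l * Real.exp (l * q.2.2))
      - a * Real.exp (l * q.2.2) * (C + c * p q.2.2)
      + compRate κ (a * Real.exp (l * q.2.1)) (Y q.1) with hρ
  set K : Set (ℝ × ℝ × ℝ) := Icc 0 T ×ˢ Icc 0 T ×ˢ Icc 0 T with hK
  have hKc : IsCompact K := isCompact_Icc.prod (isCompact_Icc.prod isCompact_Icc)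
  have m1 : MapsTo (fun q : ℝ × ℝ × ℝ => q.1) K (Ici 0) := fun q hq => hq.1.1
  have m2 : MapsTo (fun q : ℝ × ℝ × ℝ => q.2.1) K (Ici 0) := fun q hq => hq.2.1.1
  have m3 : MapsTo (fun q : ℝ × ℝ × ℝ => q.2.2) K (Ici 0) := fun q hq => hq.2.2.1
  have hρc : ContinuousOn ρ K := by
    have y1 : ContinuousOn (fun q : ℝ × ℝ × ℝ => Y q.1) K := hY.comp (by fun_prop) m1
    have y2 : ContinuousOn (fun q : ℝ × ℝ × ℝ => Y q.2.1) K := hY.comp (by fun_prop) m2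
    have n1 : ContinuousOn (fun q : ℝ × ℝ × ℝ => N q.1) K := hN.comp (by fun_prop) m1
    have n2 : ContinuousOn (fun q : ℝ × ℝ × ℝ => N q.2.1) K := hN.comp (by fun_prop) m2
    have b3 : ContinuousOn (fun q : ℝ × ℝ × ℝ => β q.2.2) K := hβ.comp (by fun_prop) m3
    have p3 : ContinuousOn (fun q : ℝ × ℝ × ℝ => p q.2.2) K := hp.comp (by fun_prop) m3
    simp only [hρ, compRate]
    fun_prop
  have hu := Metric.uniformContinuousOn_iff.1 (hKc.uniformContinuousOn_of_continuous hρc) ε hε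
  obtain ⟨η, hη, hu⟩ := hu
  refine ⟨η, hη, fun s t hs hst htT hη' => ?_⟩
  have ht := hs.trans hst
  have hβI : IntervalIntegrable β volume s t := hβ.intervalIntegrable_of_Ici hs ht
  have hρle : ∀ v ∈ Icc s t, ρ (s, t, v) ≤ ε := by
    intro v hv
    have hv0 : v ∈ Icc 0 T := ⟨hs.trans hv.1, hv.2.trans htT⟩
    have h1 := hu (s, t, v) ⟨⟨hs, hst.trans htT⟩, ⟨ht, htT⟩, hv0⟩ (v, v, v) ⟨hv0, hv0, hv0⟩ (by
      simp only [Prod.dist_eq, Real.dist_eq]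
      refine max_lt ?_ (max_lt ?_ ?_)
      · rw [abs_lt]; constructor <;> linarith [hv.1, hv.2]
      · rw [abs_lt]; constructor <;> linarith [hv.1, hv.2]
      · simpa using hη)
    have h2 : ρ (v, v, v) ≤ 0 := by
      refine le_trans (le_of_eq ?_) (hdiag v hv0)
      simp only [hρ, sub_self, add_zero, ← two_smul ℝ (Y v), real_inner_smul_left]
      ring
    rw [Real.dist_eq] at h1
    linarith [(abs_lt.1 h1).2]
  have hpI : ∀ {u w : ℝ}, 0 ≤ u → 0 ≤ w →
      IntervalIntegrable (fun v => a * Real.exp (l * v) * (C + c * p v)) volume u w := by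
    intro u w hu hw
    exact ContinuousOn.intervalIntegrable_of_Ici (by fun_prop) hu hw
  have hβ' : IntervalIntegrable (fun v => a * Real.exp (l * t) *
      ⟪Y s + Y t + (N t - N s), β v⟫) volume s t :=
    ContinuousOn.intervalIntegrable_of_Ici (by fun_prop) hs ht
  have he' : IntervalIntegrable (fun v => a * ‖Y s‖ ^ 2 * (l * Real.exp (l * v))) volume s t :=
    ContinuousOn.intervalIntegrable_of_Ici (by fun_prop) hs ht
  have hexp : ∫ v in s..t, l * Real.exp (l * v) = Real.exp (l * t) - Real.exp (l * s) := by
    refine intervalIntegral.integral_eq_sub_of_hasDerivAt (f := fun v => Real.exp (l * v))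
      (fun v _ => ?_) (ContinuousOn.intervalIntegrable_of_Ici (by fun_prop) hs ht)
    have := ((hasDerivAt_id v).const_mul l).exp
    simpa [mul_comm] using this
  have hin : ∫ v in s..t, ⟪Y s + Y t + (N t - N s), β v⟫ =
      ⟪Y s + Y t + (N t - N s), ∫ v in s..t, β v⟫ := by
    rw [intervalIntegral.integral_of_le hst, intervalIntegral.integral_of_le hst, integral_inner]
    exact (intervalIntegrable_iff_integrableOn_Ioc_of_le hst).1 hβI
  have hcr : IntervalIntegrable (fun _ : ℝ => compRate κ (a * Real.exp (l * t)) (Y s))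
      volume s t := intervalIntegrable_const
  have h_int : ∫ v in s..t, ρ (s, t, v) =
      a * Real.exp (l * t) * ⟪Y s + Y t + (N t - N s), ∫ v in s..t, β v⟫
      + a * ‖Y s‖ ^ 2 * (Real.exp (l * t) - Real.exp (l * s))
      - (∫ v in s..t, a * Real.exp (l * v) * (C + c * p v))
      + (t - s) * compRate κ (a * Real.exp (l * t)) (Y s) := by
    simp only [hρ]
    rw [intervalIntegral.integral_add ((hβ'.add he').sub (hpI hs ht)) hcr,
      intervalIntegral.integral_sub (hβ'.add he') (hpI hs ht),
      intervalIntegral.integral_add hβ' he', intervalIntegral.integral_const_mul,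
      intervalIntegral.integral_const_mul, hexp, hin, intervalIntegral.integral_const,
      smul_eq_mul]
  have hρI : IntervalIntegrable (fun v => ρ (s, t, v)) volume s t := by
    simp only [hρ]; exact ((hβ'.add he').sub (hpI hs ht)).add hcr
  have hle : ∫ v in s..t, ρ (s, t, v) ≤ ε * (t - s) := by
    have := intervalIntegral.integral_mono_on hst hρI (intervalIntegrable_const (c := ε)) hρle
    simpa [mul_comm] using this
  have hsplit : (∫ v in (0:ℝ)..t, a * Real.exp (l * v) * (C + c * p v)) -
      ∫ v in (0:ℝ)..s, a * Real.exp (l * v) * (C + c * p v) =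
      ∫ v in s..t, a * Real.exp (l * v) * (C + c * p v) :=
    intervalIntegral.integral_interval_sub_left (hpI le_rfl ht) (hpI le_rfl hs)
  have hnorm : ‖Y t‖ ^ 2 = ‖Y s‖ ^ 2 + (2 * ⟪Y s, N t - N s⟫ + ‖N t - N s‖ ^ 2) +
      ⟪Y s + Y t + (N t - N s), ∫ v in s..t, β v⟫ := by
    rw [hNY s t hs hst]
    generalize N t - N s = n
    generalize ∫ v in s..t, β v = b
    generalize Y s = y
    simp only [← real_inner_self_eq_norm_sq, inner_add_left, inner_add_right]
    rw [real_inner_comm y n, real_inner_comm y b, real_inner_comm n b]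
    ring
  unfold energy
  rw [h_int] at hle
  have h5 := congrArg (fun x => a * Real.exp (l * t) * x) hnorm
  linarith [hsplit, hle, h5, mul_add (a * Real.exp (l * t)) (‖Y s‖ ^ 2)
    (2 * ⟪Y s, N t - N s⟫ + ‖N t - N s‖ ^ 2)]

lemma continuousOn_energy {a l C c T : ℝ} {Y : ℝ → EucSp d} {p : ℝ → ℝ} (hT : 0 ≤ T)
    (hY : ContinuousOn Y (Ici 0)) (hp : ContinuousOn p (Ici 0)) :
    ContinuousOn (energy a l C c Y p) (Icc 0 T) := by
  unfold energy
  have hY' : ContinuousOn Y (Icc 0 T) := hY.mono fun x hx => hx.1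
  refine ContinuousOn.sub (by fun_prop) ?_
  have := intervalIntegral.continuousOn_primitive_interval' (a := 0) (b₁ := 0) (b₂ := T)
    (μ := volume) (f := fun s => a * Real.exp (l * s) * (C + c * p s))
    (ContinuousOn.intervalIntegrable_of_Ici (by fun_prop) le_rfl hT) left_mem_uIcc
  rwa [uIcc_of_le hT] at this

/-- As the mesh tends to zero, the running maximum of the discretised supermartingale dominates
the exponential of the energy at every time. -/
lemma eventually_exp_energy_le_runMax {κ a l C c T : ℝ} (ha : 0 ≤ a) (hl : 0 ≤ l) (hT : 0 < T)
    {Y N β : ℝ → EucSp d} {p : ℝ → ℝ}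
    (hY : ContinuousOn Y (Ici 0)) (hN : ContinuousOn N (Ici 0)) (hβ : ContinuousOn β (Ici 0))
    (hp : ContinuousOn p (Ici 0))
    (hNY : ∀ s t, 0 ≤ s → s ≤ t → Y t = Y s + (N t - N s) + ∫ v in s..t, β v)
    (hdiag : ∀ v ∈ Icc 0 T, a * Real.exp (l * v) * (l * ‖Y v‖ ^ 2 + 2 * ⟪Y v, β v⟫ - C - c * p v)
      + compRate κ (a * Real.exp (l * v)) (Y v) ≤ 0) {ε : ℝ} (hε : 0 < ε) {t : ℝ}
    (ht : t ∈ Icc 0 T) :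
    ∀ᶠ n : ℕ in atTop, Real.exp (energy a l C c Y p t - energy a l C c Y p 0 - ε) ≤
      runMax (gridW κ a l (T / n) n Y N) n := by
  set Z := energy a l C c Y p with hZ
  obtain ⟨η₁, hη₁, hinc⟩ := exists_energy_increment_le hY hN hβ hp hNY hdiag
    (ε := ε / (2 * T)) (by positivity)
  obtain ⟨η₂, hη₂, hZc⟩ := Metric.uniformContinuousOn_iff.1
    (isCompact_Icc.uniformContinuousOn_of_continuous (continuousOn_energy (a := a) (l := l)
      (C := C) (c := c) hT.le hY hp)) (ε / 2) (by positivity)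
  have hY' : ContinuousOn Y (Icc 0 T) := hY.mono fun x hx => hx.1
  have hN' : ContinuousOn N (Icc 0 T) := hN.mono fun x hx => hx.1
  obtain ⟨M₀, hM₀⟩ := isCompact_Icc.exists_bound_of_continuousOn hY'
  set M := max M₀ 0
  have hM : ∀ s ∈ Icc 0 T, ‖Y s‖ ≤ M := fun s hs => (hM₀ s hs).trans (le_max_left _ _)
  have hM0 : 0 ≤ M := le_max_right _ _
  set A := a * Real.exp (l * T) with hA
  have hA0 : 0 ≤ A := by positivity
  obtain ⟨η₃, hη₃, hNc⟩ := Metric.uniformContinuousOn_iff.1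
    (isCompact_Icc.uniformContinuousOn_of_continuous hN') (min 1 (1 / (A * (2 * M + 1) + 1)))
    (lt_min one_pos (by positivity))
  have hmesh : Tendsto (fun n : ℕ => T / (n : ℝ)) atTop (𝓝 0) :=
    tendsto_const_div_atTop_nhds_zero_nat T
  filter_upwards [hmesh.eventually (gt_mem_nhds hη₁), hmesh.eventually (gt_mem_nhds hη₂),
    hmesh.eventually (gt_mem_nhds hη₃), eventually_gt_atTop 0,
    tendsto_natCast_atTop_atTop.eventually_ge_atTop M] with n h1 h2 h3 hn hnM
  have hn' : (0 : ℝ) < n := by exact_mod_cast hn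
  set h := T / (n : ℝ) with hh
  have hpos : 0 < h := by positivity
  have hnh : (n : ℝ) * h = T := by rw [hh]; field_simp
  have hgrid : ∀ i : ℕ, i ≤ n → (i : ℝ) * h ∈ Icc 0 T := fun i hi =>
    ⟨by positivity, by rw [← hnh]; gcongr⟩
  have hW : ∀ i : ℕ, i ≤ n → Real.exp (Z (i * h) - Z 0 - ε / (2 * T) * (i * h)) ≤
      gridW κ a l h n Y N i := by
    intro i
    induction i with
    | zero => intro _; simp [gridW]
    | succ i ih =>
      intro hi
      have ih := ih (by omega)
      have g1 := hgrid i (by omega)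
      have g2 := hgrid (i + 1) hi
      have hd : ((i + 1 : ℕ) : ℝ) * h - i * h = h := by push_cast; ring
      have hst : (i : ℝ) * h ≤ ((i + 1 : ℕ) : ℝ) * h := by linarith
      have hstep := hinc _ _ g1.1 hst g2.2 (by rw [hd]; exact h1)
      rw [hd] at hstep
      have hΔ := hNc _ g2 _ g1 (by rw [Real.dist_eq, hd, abs_of_pos hpos]; exact h3)
      rw [dist_eq_norm] at hΔ
      have hΔ1 := (hΔ.trans_le (min_le_left _ _)).le
      have hΔ2 := (hΔ.trans_le (min_le_right _ _)).le
      have hα : a * Real.exp (l * (((i + 1 : ℕ) : ℝ) * h)) ≤ A := by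
        rw [hA]; gcongr; exact g2.2
      have hα0 : 0 ≤ a * Real.exp (l * (((i + 1 : ℕ) : ℝ) * h)) := by positivity
      rw [gridW, stepFactor, if_pos]
      · refine le_trans ?_ (mul_le_mul_of_nonneg_right ih (Real.exp_pos _).le)
        rw [← Real.exp_add]
        refine Real.exp_le_exp.2 ?_
        simp only at hstep ⊢
        have : ε / (2 * T) * (((i + 1 : ℕ) : ℝ) * h) = ε / (2 * T) * (i * h) + ε / (2 * T) * h := by
          push_cast; ring
        linarith
      · refine ⟨(hM _ g1).trans hnM, hΔ1, ?_⟩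
        simp only
        set δ := ‖N (((i + 1 : ℕ) : ℝ) * h) - N (i * h)‖
        have hδ0 : 0 ≤ δ := norm_nonneg _
        calc a * Real.exp (l * (((i + 1 : ℕ) : ℝ) * h)) * (2 * ‖Y (i * h)‖ * δ + δ ^ 2)
            ≤ A * (2 * M * δ + 1 * δ) := by
              rw [sq]
              gcongr
              exact hM _ g1
          _ = A * (2 * M + 1) * δ := by ring
          _ ≤ (A * (2 * M + 1) + 1) * (1 / (A * (2 * M + 1) + 1)) := by
              gcongr
              linarith
          _ = 1 := by field_simp
  set i := ⌊t / h⌋₊ with hi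
  have hi1 : (i : ℝ) * h ≤ t := by
    rw [← le_div_iff₀ hpos]; exact Nat.floor_le (by have := ht.1; positivity)
  have hi2 : t < ((i : ℝ) + 1) * h := by
    rw [← div_lt_iff₀ hpos]; exact Nat.lt_floor_add_one _
  have hin : i ≤ n := by
    have : (i : ℝ) ≤ n := by
      refine le_of_mul_le_mul_right ?_ hpos
      rw [hnh]; exact hi1.trans ht.2
    exact_mod_cast this
  have g := hgrid i hin
  have hZi := hZc _ g _ ht (by
    rw [Real.dist_eq, abs_lt]; constructor <;> linarith)
  rw [Real.dist_eq] at hZi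
  have hZi' := (abs_lt.1 hZi).1
  refine le_trans (Real.exp_le_exp.2 ?_) ((hW i hin).trans (le_runMax _ hin))
  have h6 : ε / (2 * T) * (i * h) ≤ ε / (2 * T) * T := by gcongr; exact g.2
  have h7 : ε / (2 * T) * T = ε / 2 := by field_simp
  linarith

/-- The running maxima of the discretised supermartingales yield a random variable of expectation
at most `2` dominating the square root of the exponential energy, uniformly in time. -/
lemma PathSDE.exists_energy_majorant (S : PathSDE d r₀ Ω P) {κ a l C c T : ℝ} (hκ : 0 ≤ κ)
    (ha : 0 ≤ a) (hl : 0 ≤ l) (hT : 0 < T) (ξ : Seg d r₀) (hN : NoiseBound S.ℱ P κ (S.noise ξ))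
    (hdiag : ∀ ω, ∀ v ∈ Icc 0 T, a * Real.exp (l * v) * (l * ‖S.Y ξ ω v‖ ^ 2
      + 2 * ⟪S.Y ξ ω v, S.b (S.X ξ v ω)⟫ - C - c * ‖S.X ξ v ω‖ ^ 2)
      + compRate κ (a * Real.exp (l * v)) (S.Y ξ ω v) ≤ 0) :
    ∃ F : Ω → ℝ≥0∞, ∫⁻ ω, F ω ∂P ≤ 2 ∧ ∀ ω, ∀ t ∈ Icc 0 T,
      ENNReal.ofReal (Real.exp ((energy a l C c (S.Y ξ ω) (fun v => ‖S.X ξ v ω‖ ^ 2) t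
        - energy a l C c (S.Y ξ ω) (fun v => ‖S.X ξ v ω‖ ^ 2) 0) / 2)) ≤ F ω := by
  have := S.hP
  set G : ℕ → Ω → ℝ := fun n ω =>
    √(runMax (gridW κ a l (T / n) n (S.Y ξ ω) (S.noise ξ · ω)) n) with hG
  have hGn := fun n : ℕ => integral_sqrt_runMax_gridW_le (h := T / n) (R := n) (l := l) hκ ha
    (by positivity) (Y := fun t ω => S.Y ξ ω t) (fun t ht => S.Y_meas ξ ht) hN n
  refine ⟨fun ω => liminf (fun n => ENNReal.ofReal (G n ω)) atTop, ?_, fun ω t ht => ?_⟩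
  · refine (lintegral_liminf_le fun n => (hGn n).1.ennreal_ofReal).trans ?_
    refine liminf_le_of_le (by isBoundedDefault) fun b hb => ?_
    obtain ⟨n, hn⟩ := hb.exists
    refine hn.trans ?_
    rw [← ofReal_integral_eq_lintegral_ofReal (hGn n).2.1
      (Eventually.of_forall fun ω => Real.sqrt_nonneg _)]
    simpa using ENNReal.ofReal_le_ofReal (hGn n).2.2
  · set Z := energy a l C c (S.Y ξ ω) (fun v => ‖S.X ξ v ω‖ ^ 2) with hZ
    have hev : ∀ ε > 0, ENNReal.ofReal (Real.exp ((Z t - Z 0 - ε) / 2)) ≤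
        liminf (fun n => ENNReal.ofReal (G n ω)) atTop := by
      intro ε hε
      refine le_liminf_of_le (by isBoundedDefault) ?_
      have hYc : ContinuousOn (S.Y ξ ω) (Ici 0) := (S.hYcont ξ ω).continuousOn
      have hI : ∀ s t, 0 ≤ s → 0 ≤ t →
          IntervalIntegrable (fun v => S.b (S.X ξ v ω)) volume s t :=
        fun s t hs ht => (S.continuousOn_b ξ ω).intervalIntegrable_of_Ici hs ht
      have hNY : ∀ s t, 0 ≤ s → s ≤ t → S.Y ξ ω t = S.Y ξ ω s +
          (S.noise ξ t ω - S.noise ξ s ω) + ∫ v in s..t, S.b (S.X ξ v ω) := by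
        intro s t hs hst
        rw [PathSDE.noise, PathSDE.noise, ← intervalIntegral.integral_interval_sub_left
          (hI 0 t le_rfl (hs.trans hst)) (hI 0 s le_rfl hs)]
        abel
      have hNc : ContinuousOn (fun t => S.noise ξ t ω) (Ici 0) := by
        intro x hx
        have hx0 : (0 : ℝ) ≤ x + 1 := by have : (0:ℝ) ≤ x := hx; linarith
        have h1 := intervalIntegral.continuousOn_primitive_interval' (a := 0) (b₁ := 0)
          (b₂ := x + 1) (hI 0 (x + 1) le_rfl hx0) left_mem_uIcc
        rw [uIcc_of_le hx0] at h1
        have h2 : ContinuousWithinAt (fun t => ∫ v in (0:ℝ)..t, S.b (S.X ξ v ω)) (Ici 0) x := by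
          refine (h1 x ⟨hx, by linarith⟩).mono_of_mem_nhdsWithin ?_
          rw [mem_nhdsWithin]
          exact ⟨Iio (x + 1), isOpen_Iio, by simp, fun y hy => ⟨hy.2, le_of_lt hy.1⟩⟩
        unfold PathSDE.noise
        exact (hYc x hx).sub continuousWithinAt_const |>.sub h2
      have h := eventually_exp_energy_le_runMax (κ := κ) (C := C) (c := c) ha hl hT hYc hNc
        (S.continuousOn_b ξ ω) (p := fun v => ‖S.X ξ v ω‖ ^ 2)
        ((S.continuousOn_X ξ ω).norm.pow 2) hNY (hdiag ω) hε ht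
      filter_upwards [h] with n hn
      refine ENNReal.ofReal_le_ofReal ?_
      rw [hG, Real.exp_half]
      exact Real.sqrt_le_sqrt hn
    have hlim : Tendsto (fun ε : ℝ => ENNReal.ofReal (Real.exp ((Z t - Z 0 - ε) / 2))) (𝓝[>] 0)
        (𝓝 (ENNReal.ofReal (Real.exp ((Z t - Z 0) / 2)))) := by
      have hc : Continuous (fun ε : ℝ => ENNReal.ofReal (Real.exp ((Z t - Z 0 - ε) / 2))) :=
        ENNReal.continuous_ofReal.comp (by fun_prop)
      have := hc.tendsto 0
      rw [sub_zero] at this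
      exact this.mono_left nhdsWithin_le_nhds
    exact le_of_tendsto hlim (eventually_mem_nhdsWithin.mono fun ε hε => hev ε hε)

/-- Integral form of Grönwall's inequality. -/
lemma le_mul_exp_of_le_integral {q : ℝ → ℝ} {B c K T : ℝ} (hc : 0 ≤ c)
    (hq : ContinuousOn q (Ici 0))
    (h : ∀ s ∈ Icc 0 T, q s ≤ K * (B + c * ∫ v in (0:ℝ)..s, q v)) (hK : 0 ≤ K) {t : ℝ}
    (ht : t ∈ Icc 0 T) : q t ≤ K * (B * Real.exp (c * K * t)) := by
  set u : ℝ → ℝ := fun s => B + c * ∫ v in (0:ℝ)..s, q v with hu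
  have hT : 0 ≤ T := ht.1.trans ht.2
  have hI : ContinuousOn (fun s => ∫ v in (0:ℝ)..s, q v) (Icc 0 T) := by
    have := intervalIntegral.continuousOn_primitive_interval' (a := 0) (b₁ := 0) (b₂ := T)
      (μ := volume) (hq.intervalIntegrable_of_Ici le_rfl hT) left_mem_uIcc
    rwa [uIcc_of_le hT] at this
  have hder : ∀ s ∈ Ioo 0 T, HasDerivAt (fun s => u s * Real.exp (-(c * K) * s))
      (c * q s * Real.exp (-(c * K) * s) + u s * (Real.exp (-(c * K) * s) * (-(c * K)))) s := by
    intro s hs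
    have hca : ContinuousAt q s := hq.continuousAt (Ici_mem_nhds hs.1)
    have hsm : StronglyMeasurableAtFilter q (𝓝 s) volume :=
      (hq.mono Ioi_subset_Ici_self).stronglyMeasurableAtFilter isOpen_Ioi s hs.1
    have h1 := intervalIntegral.integral_hasDerivAt_right
      (hq.intervalIntegrable_of_Ici le_rfl hs.1.le) hsm hca
    have h2 := (h1.const_mul c).const_add B
    have h3 : HasDerivAt (fun v => Real.exp (-(c * K) * v))
        (Real.exp (-(c * K) * s) * (-(c * K))) s := by
      simpa using ((hasDerivAt_id s).const_mul (-(c * K))).exp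
    exact h2.mul h3
  have hanti : AntitoneOn (fun s => u s * Real.exp (-(c * K) * s)) (Icc 0 T) := by
    refine antitoneOn_of_deriv_nonpos (convex_Icc 0 T) (by simp only [hu]; fun_prop) ?_ ?_
    · rw [interior_Icc]
      exact fun s hs => (hder s hs).differentiableAt.differentiableWithinAt
    · rw [interior_Icc]
      intro s hs
      rw [(hder s hs).deriv]
      have h1 := h s ⟨hs.1.le, hs.2.le⟩
      have h2 : 0 ≤ c * Real.exp (-(c * K) * s) * (K * u s - q s) :=
        mul_nonneg (by positivity) (by simp only [hu]; linarith)
      linarith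
  have h1 := hanti ⟨le_rfl, hT⟩ ht ht.1
  have h2 : u 0 = B := by simp [hu]
  simp only [h2, mul_zero, Real.exp_zero, mul_one] at h1
  have h3 : u t ≤ B * Real.exp (c * K * t) := by
    have := mul_le_mul_of_nonneg_right h1 (Real.exp_pos (c * K * t)).le
    rwa [mul_assoc, ← Real.exp_add, neg_mul, neg_add_cancel, Real.exp_zero, mul_one] at this
  exact (h t ht).trans (mul_le_mul_of_nonneg_left h3 hK)

lemma Seg.exists_norm_le (hr : 0 < r₀) (ζ : Seg d r₀) : ∃ θ, ‖ζ‖ ≤ ‖ζ θ‖ := by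
  have : Nonempty (Icc (-r₀) (0:ℝ)) := ⟨⟨0, by simpa using hr.le, le_rfl⟩⟩
  obtain ⟨θ, -, hθ⟩ := isCompact_univ.exists_isMaxOn univ_nonempty ζ.continuous.norm.continuousOn
  exact ⟨θ, (ContinuousMap.norm_le _ (norm_nonneg _)).2 fun y => hθ (mem_univ y)⟩

/-- A bound on the energy controls the segment norm, with an exponentially decaying dependence on
the initial segment. -/
lemma PathSDE.norm_X_sq_le (S : PathSDE d r₀ Ω P) {a l C c T x : ℝ} (ha : 0 < a) (hl : 0 ≤ l)
    (hC : 0 ≤ C) (hc : 0 ≤ c) (hx : 0 ≤ x) (ξ : Seg d r₀) (ω : Ω)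
    (hZ : ∀ t ∈ Icc 0 T, energy a l C c (S.Y ξ ω) (fun v => ‖S.X ξ v ω‖ ^ 2) t
        - energy a l C c (S.Y ξ ω) (fun v => ‖S.X ξ v ω‖ ^ 2) 0 ≤ x) {t : ℝ} (ht : t ∈ Icc 0 T) :
    ‖S.X ξ t ω‖ ^ 2 ≤ Real.exp (l * r₀) * Real.exp ((c * Real.exp (l * r₀) - l) * t) *
      (‖ξ‖ ^ 2 + C * (T * Real.exp (l * T)) + x / a) := by
  have hr := S.hr₀
  set q : ℝ → ℝ := fun v => Real.exp (l * v) * ‖S.X ξ v ω‖ ^ 2 with hq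
  have hXc := S.continuousOn_X ξ ω
  have hqc : ContinuousOn q (Ici 0) := by
    have := hXc.norm
    simp only [hq]; fun_prop
  have hq0 : ∀ v, 0 ≤ q v := fun v => by simp only [hq]; positivity
  set B := ‖ξ‖ ^ 2 + C * (T * Real.exp (l * T)) + x / a with hB
  have hT : 0 ≤ T := ht.1.trans ht.2
  have key : ∀ s ∈ Icc 0 T, q s ≤ Real.exp (l * r₀) * (B + c * ∫ v in (0:ℝ)..s, q v) := by
    intro s hs
    set J := ∫ v in (0:ℝ)..s, q v with hJ
    have hJ0 : 0 ≤ J := intervalIntegral.integral_nonneg hs.1 fun v _ => hq0 v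
    have hBJ : ‖ξ‖ ^ 2 ≤ B + c * J := by
      have : 0 ≤ C * (T * Real.exp (l * T)) := by positivity
      have : 0 ≤ x / a := by positivity
      have : 0 ≤ c * J := by positivity
      linarith
    have hBJ0 : 0 ≤ B + c * J := (sq_nonneg _).trans hBJ
    have hpt : ∀ θ : Icc (-r₀) (0:ℝ), Real.exp (l * s) * ‖S.X ξ s ω θ‖ ^ 2 ≤
        Real.exp (l * r₀) * (B + c * J) := by
      intro θ
      rw [S.hX ξ s hs.1 ω θ]
      rcases le_total 0 (s + θ.1) with h0 | h0
      · have hvs : s + θ.1 ≤ s := by linarith [θ.2.2]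
        have h1 := hZ (s + θ.1) ⟨h0, hvs.trans hs.2⟩
        have hg0 : ∀ w, 0 ≤ a * Real.exp (l * w) * (C + c * ‖S.X ξ w ω‖ ^ 2) :=
          fun w => by positivity
        have hgI : ∀ {u w : ℝ}, 0 ≤ u → 0 ≤ w → IntervalIntegrable
            (fun w => a * Real.exp (l * w) * (C + c * ‖S.X ξ w ω‖ ^ 2)) volume u w := by
          intro u w hu hw
          refine ContinuousOn.intervalIntegrable_of_Ici ?_ hu hw
          have := hXc.norm
          fun_prop
        have h2 : ∫ w in (0:ℝ)..(s + θ.1), a * Real.exp (l * w) * (C + c * ‖S.X ξ w ω‖ ^ 2) ≤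
            ∫ w in (0:ℝ)..s, a * Real.exp (l * w) * (C + c * ‖S.X ξ w ω‖ ^ 2) :=
          intervalIntegral.integral_mono_interval le_rfl h0 hvs
            (Eventually.of_forall hg0) (hgI le_rfl hs.1)
        have h3 : ∫ w in (0:ℝ)..s, a * Real.exp (l * w) * (C + c * ‖S.X ξ w ω‖ ^ 2) ≤
            a * (C * (T * Real.exp (l * T)) + c * J) := by
          have e1 : ∫ w in (0:ℝ)..s, a * Real.exp (l * w) * (C + c * ‖S.X ξ w ω‖ ^ 2) ≤
              ∫ w in (0:ℝ)..s, (a * C * Real.exp (l * T) + a * c * q w) := by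
            refine intervalIntegral.integral_mono_on hs.1 (hgI le_rfl hs.1)
              (ContinuousOn.intervalIntegrable_of_Ici (by fun_prop) le_rfl hs.1) fun w hw => ?_
            have : a * C * Real.exp (l * w) ≤ a * C * Real.exp (l * T) := by
              gcongr; exact hw.2.trans hs.2
            simp only [hq]
            linarith
          rw [intervalIntegral.integral_add intervalIntegrable_const
            (ContinuousOn.intervalIntegrable_of_Ici (by fun_prop) le_rfl hs.1),
            intervalIntegral.integral_const, intervalIntegral.integral_const_mul, sub_zero,
            smul_eq_mul] at e1
          have : s * (a * C * Real.exp (l * T)) ≤ T * (a * C * Real.exp (l * T)) := by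
            gcongr; exact hs.2
          linarith
        have h4 : ‖S.Y ξ ω 0‖ ^ 2 ≤ ‖ξ‖ ^ 2 := by
          have := S.hY0 ξ ω ⟨0, by simpa using hr.le, le_rfl⟩
          simp only at this
          rw [this]
          gcongr
          exact ξ.norm_coe_le_norm _
        have h5 : Real.exp (l * (s + θ.1)) * ‖S.Y ξ ω (s + θ.1)‖ ^ 2 ≤ B + c * J := by
          unfold energy at h1
          simp only [intervalIntegral.integral_same, mul_zero, Real.exp_zero, mul_one,
            sub_zero] at h1
          have h6 : a * ‖S.Y ξ ω 0‖ ^ 2 ≤ a * ‖ξ‖ ^ 2 := by gcongr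
          have h7 : a * (x / a) = x := by field_simp
          refine le_of_mul_le_mul_left ?_ ha
          rw [hB]
          linarith
        have h8 : Real.exp (l * s) ≤ Real.exp (l * r₀) * Real.exp (l * (s + θ.1)) := by
          rw [← Real.exp_add, Real.exp_le_exp]
          have := mul_nonneg hl (by linarith [θ.2.1] : 0 ≤ r₀ + θ.1)
          linarith
        calc _ ≤ Real.exp (l * r₀) * Real.exp (l * (s + θ.1)) * ‖S.Y ξ ω (s + θ.1)‖ ^ 2 := by
              gcongr
          _ = Real.exp (l * r₀) * (Real.exp (l * (s + θ.1)) * ‖S.Y ξ ω (s + θ.1)‖ ^ 2) := by ring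
          _ ≤ _ := by gcongr
      · have hmem : s + θ.1 ∈ Icc (-r₀) 0 := ⟨by linarith [θ.2.1, hs.1], h0⟩
        rw [S.hY0 ξ ω ⟨s + θ.1, hmem⟩]
        have h1 : ‖ξ ⟨s + θ.1, hmem⟩‖ ^ 2 ≤ B + c * J := by
          refine le_trans ?_ hBJ
          gcongr
          exact ξ.norm_coe_le_norm _
        have h2 : s ≤ r₀ := by linarith [θ.2.1]
        gcongr
    obtain ⟨θ, hθ⟩ := Seg.exists_norm_le hr (S.X ξ s ω)
    refine le_trans ?_ (hpt θ)
    simp only [hq]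
    gcongr
  have h := le_mul_exp_of_le_integral hc hqc key (Real.exp_pos _).le ht
  refine le_of_mul_le_mul_left (h.trans (le_of_eq ?_)) (Real.exp_pos (l * t))
  have : Real.exp (c * Real.exp (l * r₀) * t) =
      Real.exp (l * t) * Real.exp ((c * Real.exp (l * r₀) - l) * t) := by
    rw [← Real.exp_add]; ring_nf
  rw [this]; ring

/-- Exponential moments over a finite horizon, with a contraction of the exponent at its end. -/
lemma PathSDE.exists_lintegral_exp_le (S : PathSDE d r₀ Ω P) :
    ∃ δ T K m : ℝ, 0 < δ ∧ 0 < T ∧ 0 ≤ K ∧ 0 ≤ m ∧ ∀ ξ,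
      (∀ t ∈ Icc 0 T, ∫⁻ ω, ENNReal.ofReal (Real.exp (δ * ‖S.X ξ t ω‖ ^ 2)) ∂P ≤
        ENNReal.ofReal (K * Real.exp (m * ‖ξ‖ ^ 2))) ∧
      ∫⁻ ω, ENNReal.ofReal (Real.exp (δ * ‖S.X ξ T ω‖ ^ 2)) ∂P ≤
        ENNReal.ofReal (K * Real.exp (δ / 2 * ‖ξ‖ ^ 2)) := by
  have := S.hP
  have hr := S.hr₀
  obtain ⟨κ, hκ, hN⟩ := S.exists_noiseBound
  obtain ⟨l, l₂, hl, hl₂, hll, hA2⟩ := S.hA2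
  set E := Real.exp (l * r₀) with hE
  have hE0 : 0 < E := Real.exp_pos _
  set ε := (l - l₂ * E) / (4 * E) with hε
  have hε0 : 0 < ε := by
    rw [hε]; exact div_pos (by linarith) (by positivity)
  set c := l₂ + 2 * ε with hc
  have hc0 : 0 ≤ c := by positivity
  have hcl : c * E - l < 0 := by
    have : ε * E * 4 = l - l₂ * E := by rw [hε]; field_simp
    have : c * E = l₂ * E + 2 * (ε * E) := by rw [hc]; ring
    linarith
  set T := (Real.log 2 + l * r₀) / (l - c * E) with hT
  have hT0 : 0 < T := by
    rw [hT]
    have := Real.log_pos one_lt_two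
    exact div_pos (by positivity) (by linarith)
  have hTE : E * Real.exp ((c * E - l) * T) = 1 / 2 := by
    have h1 : (c * E - l) * T = -(Real.log 2 + l * r₀) := by
      rw [hT]
      have : l - c * E ≠ 0 := by linarith
      field_simp
      ring
    rw [h1, hE, ← Real.exp_add]
    have : l * r₀ + -(Real.log 2 + l * r₀) = -Real.log 2 := by ring
    rw [this, Real.exp_neg, Real.exp_log two_pos]
    norm_num
  set M := Real.exp (l * T) with hM
  have hM0 : 0 < M := Real.exp_pos _
  set a := min 1 (ε / (8 * κ * M + 1)) with ha
  have ha0 : 0 < a := lt_min one_pos (by positivity)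
  have ha1 : a ≤ 1 := min_le_left _ _
  have ha2 : 8 * κ * (a * M) ≤ ε := by
    have h1 : a ≤ ε / (8 * κ * M + 1) := min_le_right _ _
    rw [le_div_iff₀ (by positivity)] at h1
    linarith
  set C := ‖S.b 0‖ ^ 2 / ε + κ * (1 + 2 * M) with hC
  have hC0 : 0 ≤ C := by positivity
  set δ := a / (2 * E) with hδ
  have hδ0 : 0 < δ := by positivity
  set D := a * (C * (T * M)) / 2 with hD
  have hdiag : ∀ ξ ω, ∀ v ∈ Icc 0 T, a * Real.exp (l * v) * (l * ‖S.Y ξ ω v‖ ^ 2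
      + 2 * ⟪S.Y ξ ω v, S.b (S.X ξ v ω)⟫ - C - c * ‖S.X ξ v ω‖ ^ 2)
      + compRate κ (a * Real.exp (l * v)) (S.Y ξ ω v) ≤ 0 := by
    intro ξ ω v hv
    have h1 := hA2 (S.X ξ v ω) 0
    have h00 : ev0 S.hr₀ (0 : Seg d r₀) = 0 := rfl
    rw [S.ev0_X ξ hv.1, h00, sub_zero, sub_zero, inner_sub_right] at h1
    have hYX : ‖S.Y ξ ω v‖ ≤ ‖S.X ξ v ω‖ := by
      rw [← S.ev0_X ξ hv.1]; exact (S.X ξ v ω).norm_coe_le_norm _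
    have hYX2 : ‖S.Y ξ ω v‖ ^ 2 ≤ ‖S.X ξ v ω‖ ^ 2 := by gcongr
    set y := S.Y ξ ω v with hy
    set α := a * Real.exp (l * v) with hα
    have hα0 : 0 < α := by positivity
    have hαM : α ≤ a * M := by
      rw [hα, hM]; gcongr; exact hv.2
    have hαM1 : α ≤ M := hαM.trans (by nlinarith)
    have h2 : 2 * ⟪y, S.b 0⟫ ≤ ε * ‖y‖ ^ 2 + ‖S.b 0‖ ^ 2 / ε := by
      have e1 := real_inner_le_norm y (S.b 0)
      have e2 : ε * ‖y‖ ^ 2 + ‖S.b 0‖ ^ 2 / ε - 2 * (‖y‖ * ‖S.b 0‖) =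
          (ε * ‖y‖ - ‖S.b 0‖) ^ 2 / ε := by field_simp; ring
      have e3 : 0 ≤ (ε * ‖y‖ - ‖S.b 0‖) ^ 2 / ε := by positivity
      linarith
    have h3 : compRate κ α y = α * (κ + κ * α * (8 * ‖y‖ ^ 2 + 2)) := by
      unfold compRate; ring
    have h4 : κ * α * 8 ≤ ε := by
      refine le_trans ?_ ha2
      have := mul_le_mul_of_nonneg_left hαM hκ
      linarith
    have h5 : κ * α * (8 * ‖y‖ ^ 2 + 2) ≤ ε * ‖y‖ ^ 2 + 2 * κ * M := by
      have e1 := mul_le_mul_of_nonneg_right h4 (sq_nonneg ‖y‖)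
      have e2 := mul_le_mul_of_nonneg_left hαM1 hκ
      linarith
    rw [h3, ← mul_add]
    refine mul_nonpos_of_nonneg_of_nonpos hα0.le ?_
    have h6 : 2 * ε * ‖y‖ ^ 2 ≤ 2 * ε * ‖S.X ξ v ω‖ ^ 2 := by gcongr
    rw [hC, hc]
    linarith
  have main : ∀ ξ, ∀ t ∈ Icc 0 T, ∫⁻ ω, ENNReal.ofReal (Real.exp (δ * ‖S.X ξ t ω‖ ^ 2)) ∂P ≤
      ENNReal.ofReal (2 * Real.exp D *
        Real.exp (δ * (E * Real.exp ((c * E - l) * t)) * ‖ξ‖ ^ 2)) := by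
    intro ξ t ht
    obtain ⟨F, hF2, hF⟩ := S.exists_energy_majorant (C := C) (c := c) hκ ha0.le hl.le hT0 ξ (hN ξ)
      (hdiag ξ)
    set Q := Real.exp D * Real.exp (δ * (E * Real.exp ((c * E - l) * t)) * ‖ξ‖ ^ 2) with hQ
    have hQ0 : 0 < Q := by positivity
    have hpt : ∀ ω, ENNReal.ofReal (Real.exp (δ * ‖S.X ξ t ω‖ ^ 2)) ≤ ENNReal.ofReal Q * F ω := by
      intro ω
      by_cases hFt : F ω = ⊤
      · rw [hFt, ENNReal.mul_top (by simpa using hQ0)]; exact le_top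
      have hF1 := hF ω 0 ⟨le_rfl, hT0.le⟩
      rw [sub_self, zero_div, Real.exp_zero, ENNReal.ofReal_one] at hF1
      have hf1 : 1 ≤ (F ω).toReal := by
        simpa using (ENNReal.toReal_le_toReal ENNReal.one_ne_top hFt).2 hF1
      set f := (F ω).toReal with hf
      have hlog : 0 ≤ Real.log f := Real.log_nonneg hf1
      have hZ : ∀ s ∈ Icc 0 T, energy a l C c (S.Y ξ ω) (fun v => ‖S.X ξ v ω‖ ^ 2) s
        - energy a l C c (S.Y ξ ω) (fun v => ‖S.X ξ v ω‖ ^ 2) 0 ≤ 2 * Real.log f := by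
        intro s hs
        have h1 := (ENNReal.ofReal_le_iff_le_toReal hFt).1 (hF ω s hs)
        have h2 := (Real.le_log_iff_exp_le (by linarith)).2 h1
        linarith
      have h1 := S.norm_X_sq_le ha0 hl.le hC0 hc0 (by linarith) ξ ω hZ ht
      rw [← ENNReal.ofReal_toReal hFt, ← hf, ← ENNReal.ofReal_mul hQ0.le]
      refine ENNReal.ofReal_le_ofReal ?_
      set e := Real.exp ((c * E - l) * t) with he
      have he1 : e ≤ 1 := by
        rw [he, Real.exp_le_one_iff]
        exact mul_nonpos_of_nonpos_of_nonneg hcl.le ht.1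
      have he0 : 0 < e := Real.exp_pos _
      have hfe : f = Real.exp (Real.log f) := (Real.exp_log (by linarith)).symm
      rw [hQ, hfe, ← Real.exp_add, ← Real.exp_add, Real.exp_le_exp]
      have hδE : δ * E = a / 2 := by rw [hδ]; field_simp
      have h2 : δ * ‖S.X ξ t ω‖ ^ 2 ≤ δ * (E * e) * ‖ξ‖ ^ 2 +
          e * (D + Real.log f) := by
        refine (mul_le_mul_of_nonneg_left h1 hδ0.le).trans (le_of_eq ?_)
        have e1 : δ * (E * e * (‖ξ‖ ^ 2 + C * (T * M) + 2 * Real.log f / a)) =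
          δ * (E * e) * ‖ξ‖ ^ 2 + (δ * E) * e * (C * (T * M) + 2 * Real.log f / a) := by ring
        rw [e1, hδE, hD]
        field_simp
      have hD0 : 0 ≤ D := by positivity
      have h3 : e * (D + Real.log f) ≤ 1 * (D + Real.log f) := by gcongr
      linarith
    calc ∫⁻ ω, ENNReal.ofReal (Real.exp (δ * ‖S.X ξ t ω‖ ^ 2)) ∂P
        ≤ ∫⁻ ω, ENNReal.ofReal Q * F ω ∂P := lintegral_mono hpt
      _ = ENNReal.ofReal Q * ∫⁻ ω, F ω ∂P := lintegral_const_mul' _ _ ENNReal.ofReal_ne_top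
      _ ≤ ENNReal.ofReal Q * 2 := by gcongr
      _ = ENNReal.ofReal (Q * 2) := by rw [ENNReal.ofReal_mul hQ0.le]; simp
      _ = _ := by rw [hQ]; ring_nf
  refine ⟨δ, T, 2 * Real.exp D, δ * E, hδ0, hT0, by positivity, by positivity, fun ξ => ⟨?_, ?_⟩⟩
  · intro t ht
    refine (main ξ t ht).trans (ENNReal.ofReal_le_ofReal ?_)
    have he1 : Real.exp ((c * E - l) * t) ≤ 1 := by
      rw [Real.exp_le_one_iff]
      exact mul_nonpos_of_nonpos_of_nonneg hcl.le ht.1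
    have : E * Real.exp ((c * E - l) * t) ≤ E := by nlinarith
    gcongr
  · refine (main ξ T ⟨hT0.le, le_rfl⟩).trans (le_of_eq ?_)
    rw [hTE]; ring_nf

lemma integrable_and_integral_le_of_lintegral_le {g : Ω → ℝ} {A : ℝ} (hA : 0 ≤ A)
    (hg : AEStronglyMeasurable g P) (hg0 : ∀ ω, 0 ≤ g ω)
    (h : ∫⁻ ω, ENNReal.ofReal (g ω) ∂P ≤ ENNReal.ofReal A) :
    Integrable g P ∧ ∫ ω, g ω ∂P ≤ A := by
  refine ⟨⟨hg, ?_⟩, ?_⟩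
  · rw [hasFiniteIntegral_iff_ofReal (Eventually.of_forall hg0)]
    exact h.trans_lt ENNReal.ofReal_lt_top
  · rw [integral_eq_lintegral_of_nonneg_ae (Eventually.of_forall hg0) hg]
    exact ENNReal.toReal_le_of_le_ofReal hA h

lemma PathSDE.measurable_X (S : PathSDE d r₀ Ω P) (ξ : Seg d r₀) {t : ℝ} (ht : 0 ≤ t) :
    Measurable (S.X ξ t) :=
  ((S.hXadapted ξ t ht).mono (S.ℱ.le t)).measurable

lemma continuous_exp_mul_norm_sq (δ : ℝ) :
    Continuous fun ζ : Seg d r₀ => Real.exp (δ * ‖ζ‖ ^ 2) := by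
  fun_prop

/-- One application of the Markov property contracts exponential moments, up to a constant. -/
lemma PathSDE.lintegral_exp_add_le (S : PathSDE d r₀ Ω P) {δ T K : ℝ} (hT : 0 ≤ T) (hK : 0 ≤ K)
    (hcontr : ∀ ξ, ∫⁻ ω, ENNReal.ofReal (Real.exp (δ * ‖S.X ξ T ω‖ ^ 2)) ∂P ≤
        ENNReal.ofReal (K * Real.exp (δ / 2 * ‖ξ‖ ^ 2)))
    (ξ : Seg d r₀) {s A : ℝ} (hs : 0 ≤ s) (hA : 0 ≤ A)
    (h : ∫⁻ ω, ENNReal.ofReal (Real.exp (δ * ‖S.X ξ s ω‖ ^ 2)) ∂P ≤ ENNReal.ofReal A) :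
    ∫⁻ ω, ENNReal.ofReal (Real.exp (δ * ‖S.X ξ (s + T) ω‖ ^ 2)) ∂P ≤
      ENNReal.ofReal (A / 2 + K ^ 2 / 2) := by
  have := S.hP
  have hc := continuous_exp_mul_norm_sq (d := d) (r₀ := r₀) δ
  set f : ℕ → Seg d r₀ → ℝ := fun n ζ => min (Real.exp (δ * ‖ζ‖ ^ 2)) n with hf
  have hfm : ∀ n, Measurable (f n) := fun n => (hc.min continuous_const).measurable
  have hf0 : ∀ n ζ, 0 ≤ f n ζ := fun n ζ => le_min (Real.exp_pos _).le n.cast_nonneg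
  have hfX : ∀ n ζ {t : ℝ}, 0 ≤ t → Measurable (fun ω => f n (S.X ζ t ω)) :=
    fun n ζ t ht => (hfm n).comp (S.measurable_X ζ ht)
  obtain ⟨hI, hIA⟩ := integrable_and_integral_le_of_lintegral_le
    (g := fun ω => Real.exp (δ * ‖S.X ξ s ω‖ ^ 2)) hA
    (hc.measurable.comp (S.measurable_X ξ hs)).aestronglyMeasurable
    (fun ω => (Real.exp_pos _).le) h
  have hinner : ∀ n ζ, ∫ ω, f n (S.X ζ T ω) ∂P ≤ Real.exp (δ * ‖ζ‖ ^ 2) / 2 + K ^ 2 / 2 := by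
    intro n ζ
    have h1 := (integrable_and_integral_le_of_lintegral_le (by positivity)
      (hfX n ζ hT).aestronglyMeasurable (fun ω => hf0 n _)
      ((lintegral_mono fun ω => ENNReal.ofReal_le_ofReal (min_le_left _ _)).trans
        (hcontr ζ))).2
    refine h1.trans ?_
    have h2 : Real.exp (δ * ‖ζ‖ ^ 2) = Real.exp (δ / 2 * ‖ζ‖ ^ 2) ^ 2 := by
      rw [← Real.exp_nat_mul]; congr 1; push_cast; ring
    rw [h2]
    linarith [sq_nonneg (K - Real.exp (δ / 2 * ‖ζ‖ ^ 2))]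
  have hstep : ∀ n, ∫ ω, f n (S.X ξ (s + T) ω) ∂P ≤ A / 2 + K ^ 2 / 2 := by
    intro n
    rw [S.hMarkov (f n) (hfm n) ⟨n, fun ζ => by
      rw [abs_of_nonneg (hf0 n ζ)]; exact min_le_right _ _⟩ s hs T hT ξ]
    have h1 : ∫ ω, ∫ ω', f n (S.X (S.X ξ s ω) T ω') ∂P ∂P ≤
        ∫ ω, (Real.exp (δ * ‖S.X ξ s ω‖ ^ 2) / 2 + K ^ 2 / 2) ∂P :=
      integral_mono_of_nonneg (Eventually.of_forall fun ω => integral_nonneg fun ω' => hf0 n _)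
        ((hI.div_const 2).add (integrable_const _)) (Eventually.of_forall fun ω => hinner n _)
    refine h1.trans ?_
    rw [integral_add (hI.div_const 2) (integrable_const _), integral_div]
    simp only [integral_const, probReal_univ, one_smul]
    linarith
  calc ∫⁻ ω, ENNReal.ofReal (Real.exp (δ * ‖S.X ξ (s + T) ω‖ ^ 2)) ∂P
      ≤ ∫⁻ ω, liminf (fun n => ENNReal.ofReal (f n (S.X ξ (s + T) ω))) atTop ∂P := by
        refine lintegral_mono fun ω => le_liminf_of_le (by isBoundedDefault) ?_
        filter_upwards [tendsto_natCast_atTop_atTop.eventually_ge_atTop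
          (Real.exp (δ * ‖S.X ξ (s + T) ω‖ ^ 2))] with n hn
        exact ENNReal.ofReal_le_ofReal (le_min le_rfl hn)
    _ ≤ liminf (fun n => ∫⁻ ω, ENNReal.ofReal (f n (S.X ξ (s + T) ω)) ∂P) atTop :=
        lintegral_liminf_le fun n => (hfX n ξ (by positivity)).ennreal_ofReal
    _ ≤ ENNReal.ofReal (A / 2 + K ^ 2 / 2) := by
        refine liminf_le_of_le (by isBoundedDefault) fun b hb => ?_
        obtain ⟨n, hn⟩ := hb.exists
        refine hn.trans ?_
        have hbdd : Integrable (fun ω => f n (S.X ξ (s + T) ω)) P :=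
          Integrable.of_bound (hfX n ξ (by positivity)).aestronglyMeasurable n
            (Eventually.of_forall fun ω => by
              rw [Real.norm_of_nonneg (hf0 n _)]; exact min_le_right _ _)
        rw [← ofReal_integral_eq_lintegral_ofReal hbdd (Eventually.of_forall fun ω => hf0 n _)]
        exact ENNReal.ofReal_le_ofReal (hstep n)

/-- Exponential moments of the segment process are bounded uniformly in time. -/
lemma PathSDE.exists_integral_exp_le (S : PathSDE d r₀ Ω P) :
    ∃ δ K m : ℝ, 0 < δ ∧ 0 ≤ K ∧ 0 ≤ m ∧ ∀ ξ t, 0 ≤ t →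
      Integrable (fun ω => Real.exp (δ * ‖S.X ξ t ω‖ ^ 2)) P ∧
      ∫ ω, Real.exp (δ * ‖S.X ξ t ω‖ ^ 2) ∂P ≤ K * Real.exp (m * ‖ξ‖ ^ 2) + K ^ 2 := by
  obtain ⟨δ, T, K, m, hδ, hT, hK, hm, hS⟩ := S.exists_lintegral_exp_le
  refine ⟨δ, K, m, hδ, hK, hm, fun ξ t ht => ?_⟩
  have hA0 : 0 ≤ K * Real.exp (m * ‖ξ‖ ^ 2) + K ^ 2 := by positivity
  have hn : ∀ n : ℕ, ∀ s ∈ Icc 0 T,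
      ∫⁻ ω, ENNReal.ofReal (Real.exp (δ * ‖S.X ξ (s + n * T) ω‖ ^ 2)) ∂P ≤
        ENNReal.ofReal (K * Real.exp (m * ‖ξ‖ ^ 2) + K ^ 2) := by
    intro n
    induction n with
    | zero =>
      intro s hs
      simp only [Nat.cast_zero, zero_mul, add_zero]
      refine ((hS ξ).1 s hs).trans (ENNReal.ofReal_le_ofReal ?_)
      linarith [sq_nonneg K]
    | succ n ih =>
      intro s hs
      have h1 := S.lintegral_exp_add_le hT.le hK (fun ζ => (hS ζ).2) ξ
        (add_nonneg hs.1 (by positivity)) hA0 (ih s hs)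
      have h2 : s + ((n + 1 : ℕ) : ℝ) * T = s + n * T + T := by push_cast; ring
      rw [h2]
      refine h1.trans (ENNReal.ofReal_le_ofReal ?_)
      have : 0 ≤ K * Real.exp (m * ‖ξ‖ ^ 2) := by positivity
      linarith
  have h1 : (⌊t / T⌋₊ : ℝ) * T ≤ t := by
    rw [← le_div_iff₀ hT]; exact Nat.floor_le (by positivity)
  have h2 : t < (⌊t / T⌋₊ + 1) * T := by
    rw [← div_lt_iff₀ hT]; exact Nat.lt_floor_add_one _
  have h3 := hn ⌊t / T⌋₊ (t - ⌊t / T⌋₊ * T) ⟨by linarith, by linarith⟩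
  rw [sub_add_cancel] at h3
  exact integrable_and_integral_le_of_lintegral_le hA0
    ((continuous_exp_mul_norm_sq δ).measurable.comp (S.measurable_X ξ ht)).aestronglyMeasurable
    (fun ω => (Real.exp_pos _).le) h3

/-- The segments at the times `k + j r₀` cover the path on `[k - r₀, k + 1]`. -/
lemma PathSDE.exists_norm_X_le (S : PathSDE d r₀ Ω P) (ξ : Seg d r₀) (ω : Ω) {k t : ℝ}
    (hk : 0 ≤ k) (ht : t ∈ Icc k (k + 1)) :
    ∃ j ∈ Finset.range (⌈1 / r₀⌉₊ + 1), ‖S.X ξ t ω‖ ≤ ‖S.X ξ (k + j * r₀) ω‖ := by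
  have hr := S.hr₀
  obtain ⟨θ, hθ⟩ := Seg.exists_norm_le hr (S.X ξ t ω)
  have hθ1 := θ.2.1
  have hθ2 := θ.2.2
  set w := (t + θ.1 - k) / r₀ with hw
  have hwr : w * r₀ = t + θ.1 - k := by rw [hw]; field_simp
  refine ⟨⌈w⌉₊, ?_, hθ.trans ?_⟩
  · rw [Finset.mem_range, Nat.lt_succ_iff]
    refine Nat.ceil_mono ?_
    rw [hw]
    gcongr
    linarith [ht.2]
  · have h1 : w * r₀ ≤ ⌈w⌉₊ * r₀ := by gcongr; exact Nat.le_ceil w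
    have h2 : (⌈w⌉₊ : ℝ) * r₀ ≤ (w + 1) * r₀ := by
      gcongr
      rcases le_total w 0 with h | h
      · rw [Nat.ceil_eq_zero.2 h, Nat.cast_zero]
        have : -1 ≤ w := by
          rw [hw, le_div_iff₀ hr]; linarith [ht.1]
        linarith
      · exact (Nat.ceil_lt_add_one h).le
    rw [S.hX ξ t (hk.trans ht.1) ω θ]
    have h3 := S.hX ξ (k + ⌈w⌉₊ * r₀) (by positivity) ω
      ⟨t + θ.1 - (k + ⌈w⌉₊ * r₀), by linarith, by linarith⟩
    simp only [add_sub_cancel] at h3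
    rw [← h3]
    exact (S.X ξ (k + ⌈w⌉₊ * r₀) ω).norm_coe_le_norm _

/-- **Lemma 4.3 (exponential moment bound).** Under (A1)–(A3), there exist `δ, c > 0`
with `E(sup_{t∈[k,k+1]} e^{δ‖X_t^ξ‖²}) ≤ e^{c(1+‖ξ‖²)}` for all integers `k ≥ 0` and
`ξ ∈ 𝒞`. -/
theorem exponential_moment_bound (S : PathSDE d r₀ Ω P) :
    ∃ δ c : ℝ, 0 < δ ∧ 0 < c ∧
      ∀ (k : ℕ) (ξ : Seg d r₀),
        (∫ ω, (⨆ t : Set.Icc (k : ℝ) ((k : ℝ) + 1),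
            Real.exp (δ * ‖S.X ξ (t : ℝ) ω‖ ^ 2)) ∂P)
          ≤ Real.exp (c * (1 + ‖ξ‖ ^ 2)) := by
  obtain ⟨δ, K, m, hδ, hK, hm, hS⟩ := S.exists_integral_exp_le
  have hr := S.hr₀
  set J := ⌈1 / r₀⌉₊ + 1
  refine ⟨δ, m + J * (K + K ^ 2) + 1, hδ, by positivity, fun k ξ => ?_⟩
  have hI : ∀ j ∈ Finset.range J,
      Integrable (fun ω => Real.exp (δ * ‖S.X ξ (k + j * r₀) ω‖ ^ 2)) P :=
    fun j _ => (hS ξ _ (by positivity)).1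
  have hnn : ∀ ω, 0 ≤ ⨆ t : Set.Icc (k : ℝ) ((k : ℝ) + 1),
      Real.exp (δ * ‖S.X ξ (t : ℝ) ω‖ ^ 2) :=
    fun ω => Real.iSup_nonneg fun t => (Real.exp_pos _).le
  have hle : ∀ ω, (⨆ t : Set.Icc (k : ℝ) ((k : ℝ) + 1), Real.exp (δ * ‖S.X ξ (t : ℝ) ω‖ ^ 2)) ≤
      ∑ j ∈ Finset.range J, Real.exp (δ * ‖S.X ξ (k + j * r₀) ω‖ ^ 2) := by
    intro ω
    refine Real.iSup_le (fun t => ?_) (Finset.sum_nonneg fun j _ => (Real.exp_pos _).le)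
    obtain ⟨j, hj, hjle⟩ := S.exists_norm_X_le ξ ω k.cast_nonneg t.2
    refine le_trans ?_ (Finset.single_le_sum (f := fun j : ℕ =>
      Real.exp (δ * ‖S.X ξ (k + j * r₀) ω‖ ^ 2)) (fun j _ => (Real.exp_pos _).le) hj)
    gcongr
  calc ∫ ω, (⨆ t : Set.Icc (k : ℝ) ((k : ℝ) + 1), Real.exp (δ * ‖S.X ξ (t : ℝ) ω‖ ^ 2)) ∂P
      ≤ ∫ ω, ∑ j ∈ Finset.range J, Real.exp (δ * ‖S.X ξ (k + j * r₀) ω‖ ^ 2) ∂P :=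
        integral_mono_of_nonneg (Eventually.of_forall hnn) (integrable_finsetSum _ hI)
          (Eventually.of_forall hle)
    _ = ∑ j ∈ Finset.range J, ∫ ω, Real.exp (δ * ‖S.X ξ (k + j * r₀) ω‖ ^ 2) ∂P :=
        integral_finsetSum _ hI
    _ ≤ ∑ _j ∈ Finset.range J, (K * Real.exp (m * ‖ξ‖ ^ 2) + K ^ 2) :=
        Finset.sum_le_sum fun j _ => (hS ξ _ (by positivity)).2
    _ = J * (K * Real.exp (m * ‖ξ‖ ^ 2) + K ^ 2) := by simp [mul_add]
    _ ≤ J * (K * Real.exp (m * ‖ξ‖ ^ 2) + K ^ 2 * Real.exp (m * ‖ξ‖ ^ 2)) := by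
        gcongr
        exact le_mul_of_one_le_right (by positivity) (Real.one_le_exp (by positivity))
    _ = J * (K + K ^ 2) * Real.exp (m * ‖ξ‖ ^ 2) := by ring
    _ ≤ Real.exp (J * (K + K ^ 2)) * Real.exp (m * ‖ξ‖ ^ 2) := by
        gcongr
        linarith [Real.add_one_le_exp (J * (K + K ^ 2))]
    _ = Real.exp (J * (K + K ^ 2) + m * ‖ξ‖ ^ 2) := (Real.exp_add _ _).symm
    _ ≤ Real.exp ((m + J * (K + K ^ 2) + 1) * (1 + ‖ξ‖ ^ 2)) := by
        rw [Real.exp_le_exp]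
        have : 0 ≤ J * (K + K ^ 2) * ‖ξ‖ ^ 2 := by positivity
        linarith [sq_nonneg ‖ξ‖]
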